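/- arXiv:2601.08535 — 9 statements merged into one kernel-verified Lean document; each statement's English description precedes it below -/
import Mathlib

section
/- Let π⁰ be a probability vector on [d] and let 0 < Δ ≤ ‖π⁰‖. Set α = nΔ² / (nΔ² + 1 − (‖π⁰‖ − Δ)²) and define the interpolated estimator π̂^ip(X^n) = α·π^em(X^n) + (1 − α)·π⁰. Then for every probability vector π ∈ B(π⁰, Δ), E[‖π − π̂^ip(X^n)‖²] ≤ min( Δ², (1 − (‖π⁰‖ − Δ)²)/n ). -/
open Finset

/-- `π` is a probability vector on `Fin d`: nonnegative coordinates summing to 1. -/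
def IsProbVec {d : ℕ} (π : Fin d → ℝ) : Prop :=
  (∀ i, 0 ≤ π i) ∧ ∑ i, π i = 1

/-- Probability of observing the sample sequence `x` under i.i.d. draws from `π`
(the `n`-fold product law of `π`). -/
noncomputable def prodProb {d n : ℕ} (π : Fin d → ℝ) (x : Fin n → Fin d) : ℝ :=
  ∏ k, π (x k)

/-- Expectation of `f (X^n)` where `X^n = (X_1,…,X_n)` are i.i.d. samples from `π`. -/
noncomputable def expect {d n : ℕ} (π : Fin d → ℝ) (f : (Fin n → Fin d) → ℝ) : ℝ :=
  ∑ x : Fin n → Fin d, prodProb π x * f x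

/-- `N_i`: the number of occurrences of symbol `i` in the sample `x`. -/
def cnt {d n : ℕ} (x : Fin n → Fin d) (i : Fin d) : ℕ :=
  (Finset.univ.filter (fun k => x k = i)).card

/-- The empirical estimator `π^em(x) i = N_i / n`. -/
noncomputable def empDist {d n : ℕ} (x : Fin n → Fin d) : Fin d → ℝ :=
  fun i => (cnt x i : ℝ) / n

/-- Squared Euclidean (ℓ2) distance `‖u - v‖²`. -/
noncomputable def sqDist {d : ℕ} (u v : Fin d → ℝ) : ℝ := ∑ i, (u i - v i) ^ 2

/-- Euclidean (ℓ2) norm. -/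
noncomputable def l2norm {d : ℕ} (u : Fin d → ℝ) : ℝ := Real.sqrt (∑ i, u i ^ 2)

theorem aux_prod {d n : ℕ} (π : Fin d → ℝ) (h : Fin n → Fin d → ℝ) :
    expect π (fun x => ∏ k, h k (x k)) = ∏ k, ∑ a, π a * h k a := by
  unfold _root_.expect prodProb
  rw [Finset.prod_univ_sum, Fintype.piFinset_univ]
  simp only [Finset.prod_mul_distrib]

theorem aux_one {d n : ℕ} (π : Fin d → ℝ) (hs : ∑ a, π a = 1) (f : Fin d → ℝ) (k : Fin n) :
    expect π (fun x : Fin n → Fin d => f (x k)) = ∑ a, π a * f a := by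
  have h := aux_prod π (fun j a => if j = k then f a else (1 : ℝ))
  have e : ∀ j : Fin n, (∑ a, π a * (if j = k then f a else (1 : ℝ)))
      = if j = k then ∑ a, π a * f a else 1 := by
    intro j
    by_cases hj : j = k <;> simp [hj, hs]
  simp only [e] at h
  simpa [Finset.prod_ite_eq'] using h

theorem aux_two {d n : ℕ} (π : Fin d → ℝ) (hs : ∑ a, π a = 1) (f : Fin d → ℝ)
    (k l : Fin n) (hkl : k ≠ l) (h0 : ∑ a, π a * f a = 0) :
    expect π (fun x : Fin n → Fin d => f (x k) * f (x l)) = 0 := by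
  have h := aux_prod π
    (fun j a => (if j = k then f a else (1 : ℝ)) * (if j = l then f a else (1 : ℝ)))
  rw [Finset.prod_eq_zero (Finset.mem_univ k) (by simpa [hkl] using h0)] at h
  simp only [Finset.prod_mul_distrib, Finset.prod_ite_eq', Finset.mem_univ, if_true] at h
  exact h

theorem aux_const {d n : ℕ} (π : Fin d → ℝ) (hs : ∑ a, π a = 1) :
    ∑ x : Fin n → Fin d, prodProb π x = 1 := by
  have h := aux_prod (n := n) π (fun _ _ => (1 : ℝ))
  simpa [_root_.expect, hs] using h

theorem aux_sq {d n : ℕ} (π : Fin d → ℝ) (hs : ∑ a, π a = 1) (f : Fin d → ℝ)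
    (h0 : ∑ a, π a * f a = 0) (b c : ℝ) :
    expect π (fun x : Fin n → Fin d => (b + c * ∑ k, f (x k)) ^ 2)
      = b ^ 2 + c ^ 2 * (n * ∑ a, π a * f a ^ 2) := by
  have e : ∀ x : Fin n → Fin d, prodProb π x * (b + c * ∑ k, f (x k)) ^ 2
      = b ^ 2 * prodProb π x + 2 * b * c * (∑ k, prodProb π x * f (x k))
        + c ^ 2 * ∑ k, ∑ l, prodProb π x * (f (x k) * f (x l)) := by
    intro x
    simp only [← Finset.mul_sum, ← Finset.sum_mul]
    ring
  have e1 : ∑ x : Fin n → Fin d, ∑ k, prodProb π x * f (x k) = 0 := by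
    rw [Finset.sum_comm]
    refine Finset.sum_eq_zero fun k _ => ?_
    rw [← h0]
    exact aux_one π hs f k
  have e2 : ∑ x : Fin n → Fin d, ∑ k, ∑ l, prodProb π x * (f (x k) * f (x l))
      = n * ∑ a, π a * f a ^ 2 := by
    rw [Finset.sum_comm]
    have : ∀ k : Fin n, ∑ x : Fin n → Fin d, ∑ l, prodProb π x * (f (x k) * f (x l))
        = ∑ a, π a * f a ^ 2 := by
      intro k
      rw [Finset.sum_comm, Finset.sum_eq_single k]
      · have := aux_one π hs (fun a => f a ^ 2) k
        rw [← this]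
        unfold _root_.expect
        simp only [pow_two]
      · intro l _ hl
        exact aux_two π hs f k l hl.symm h0
      · simp
    simp [this]
  unfold _root_.expect
  simp only [e, Finset.sum_add_distrib, ← Finset.mul_sum, e1, e2] at *
  rw [aux_const π hs, e1, e2]
  ring

theorem aux_risk {d n : ℕ} (hn : 1 ≤ n) (π π0 : Fin d → ℝ) (hs : ∑ a, π a = 1) (α : ℝ) :
    expect π (fun x : Fin n → Fin d =>
        sqDist π (fun i => α * empDist x i + (1 - α) * π0 i))
      = (1 - α) ^ 2 * ∑ i, (π i - π0 i) ^ 2 + α ^ 2 * ((1 - ∑ i, π i ^ 2) / n) := by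
  have hn' : (n : ℝ) ≠ 0 := by positivity
  have key : ∀ i, expect π (fun x : Fin n → Fin d =>
      (π i - (α * empDist x i + (1 - α) * π0 i)) ^ 2)
      = (1 - α) ^ 2 * (π i - π0 i) ^ 2 + α ^ 2 * ((π i - π i ^ 2) / n) := by
    intro i
    have h0 : ∑ a, π a * ((if a = i then (1 : ℝ) else 0) - π i) = 0 := by
      simp [mul_sub, Finset.sum_sub_distrib, ← Finset.sum_mul, hs]
    have h2 : ∑ a, π a * ((if a = i then (1 : ℝ) else 0) - π i) ^ 2 = π i - π i ^ 2 := by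
      have : ∀ a, π a * ((if a = i then (1 : ℝ) else 0) - π i) ^ 2
          = (if a = i then π a * (1 - 2 * π i) else 0) + π a * π i ^ 2 := by
        intro a
        split_ifs <;> ring
      simp only [this, Finset.sum_add_distrib, ← Finset.sum_mul, hs]
      simp
      ring
    have h := aux_sq (n := n) π hs (fun a => (if a = i then (1 : ℝ) else 0) - π i) h0
      ((1 - α) * (π i - π0 i)) (-(α / n))
    rw [h2] at h
    have e : ∀ x : Fin n → Fin d, π i - (α * empDist x i + (1 - α) * π0 i)
        = (1 - α) * (π i - π0 i)
          + -(α / n) * ∑ k, ((if x k = i then (1 : ℝ) else 0) - π i) := by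
      intro x
      simp only [empDist, cnt, Finset.sum_sub_distrib, Finset.sum_boole, Finset.sum_const,
        Finset.card_univ, Fintype.card_fin, nsmul_eq_mul]
      field_simp
      ring
    simp only [e]
    rw [h]
    field_simp
  have : expect π (fun x : Fin n → Fin d =>
        sqDist π (fun i => α * empDist x i + (1 - α) * π0 i))
      = ∑ i, expect π (fun x : Fin n → Fin d =>
      (π i - (α * empDist x i + (1 - α) * π0 i)) ^ 2) := by
    unfold _root_.expect sqDist
    rw [Finset.sum_comm]
    simp only [Finset.mul_sum]
  rw [this]
  simp only [key, Finset.sum_add_distrib, ← Finset.mul_sum, ← Finset.sum_div,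
    Finset.sum_sub_distrib, hs]

theorem aux_tri {d : ℕ} (u v : Fin d → ℝ) :
    l2norm v - l2norm (fun i => u i - v i) ≤ l2norm u := by
  have hN : ∀ w : Fin d → ℝ, l2norm w = ‖WithLp.toLp 2 w‖ := by
    intro w
    simp [l2norm, EuclideanSpace.norm_eq]
  rw [hN, hN, hN]
  have := norm_sub_norm_le (WithLp.toLp 2 v) (WithLp.toLp 2 u)
  rw [norm_sub_rev] at this
  have e : WithLp.toLp 2 (fun i => u i - v i) = WithLp.toLp 2 u - WithLp.toLp 2 v := rfl
  rw [e]
  linarith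

/-- With α = nΔ²/(nΔ² + 1 − (‖π⁰‖−Δ)²), for every π ∈ B(π⁰,Δ),
the interpolated estimator satisfies E[‖π − π̂^ip‖²] ≤ min(Δ², (1 − (‖π⁰‖−Δ)²)/n). -/
theorem stmt_3 {d n : ℕ} (hd : 1 ≤ d) (hn : 1 ≤ n)
    (π0 : Fin d → ℝ) (hπ0 : IsProbVec π0)
    (Δ : ℝ) (hΔpos : 0 < Δ) (hΔle : Δ ≤ l2norm π0)
    (α : ℝ) (hα : α = n * Δ ^ 2 / (n * Δ ^ 2 + 1 - (l2norm π0 - Δ) ^ 2))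
    (π : Fin d → ℝ) (hπ : IsProbVec π) (hball : l2norm (fun i => π i - π0 i) ≤ Δ) :
    expect π (fun x : Fin n → Fin d =>
        sqDist π (fun i => α * empDist x i + (1 - α) * π0 i)) ≤
      min (Δ ^ 2) ((1 - (l2norm π0 - Δ) ^ 2) / n) := by
  have hn0 : (0 : ℝ) < n := by exact_mod_cast hn
  have hsqn : ∀ w : Fin d → ℝ, l2norm w ^ 2 = ∑ i, w i ^ 2 := fun w =>
    Real.sq_sqrt (Finset.sum_nonneg fun i _ => sq_nonneg _)
  rw [aux_risk hn π π0 hπ.2 α]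
  have hD : ∑ i, (π i - π0 i) ^ 2 ≤ Δ ^ 2 := by
    rw [← hsqn (fun i => π i - π0 i)]
    exact pow_le_pow_left₀ (Real.sqrt_nonneg _) hball 2
  have hV : 1 - ∑ i, π i ^ 2 ≤ 1 - (l2norm π0 - Δ) ^ 2 := by
    rw [← hsqn π]
    have h1 := aux_tri π π0
    have : (l2norm π0 - Δ) ^ 2 ≤ l2norm π ^ 2 :=
      pow_le_pow_left₀ (by linarith) (by linarith) 2
    linarith
  have hle1 : l2norm π0 ≤ 1 := by
    have h1 : l2norm π0 ^ 2 ≤ 1 := by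
      rw [hsqn, ← hπ0.2]
      refine Finset.sum_le_sum fun i _ => ?_
      have a := hπ0.1 i
      have b : π0 i ≤ 1 := by
        rw [← hπ0.2]
        exact Finset.single_le_sum (fun j _ => hπ0.1 j) (Finset.mem_univ i)
      nlinarith
    nlinarith
  have hVpos : 0 < 1 - (l2norm π0 - Δ) ^ 2 := by nlinarith
  rw [add_sub_assoc] at hα
  generalize 1 - (l2norm π0 - Δ) ^ 2 = V at *
  have hΔ2 : 0 < Δ ^ 2 := by positivity
  generalize Δ ^ 2 = D at *
  have hS : 0 < n * D + V := by positivity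
  have h1 : (1 - α) ^ 2 * ∑ i, (π i - π0 i) ^ 2 + α ^ 2 * ((1 - ∑ i, π i ^ 2) / n)
      ≤ (1 - α) ^ 2 * D + α ^ 2 * (V / n) := by gcongr
  have h2 : (1 - α) ^ 2 * D + α ^ 2 * (V / n) = D * V / (n * D + V) := by
    rw [hα]
    field_simp
    ring
  refine h1.trans ?_
  rw [h2]
  refine le_min ?_ ?_
  · rw [div_le_iff₀ hS]
    have : 0 < (n : ℝ) * D := by positivity
    nlinarith
  · rw [div_le_div_iff₀ hS hn0]
    nlinarith [sq_nonneg V]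
end

section
/- Let d ≥ 2, let π⁰ be a probability vector on [d], and let 0 < Δ ≤ 1. Then for every estimator π̂ : [d]^n → ℝ^d there exists a probability vector π ∈ B(π⁰, Δ) with E[‖π − π̂(X^n)‖²] ≥ min( Δ²/32, Δ/(100n) ) · e^{−4/5}. -/
open Finset

lemma aux_pt (p q R l x y : ℝ) (hp : 0 ≤ p) (hq : 0 ≤ q) (hR : R ^ 2 = p * q) :
    (x - y) ^ 2 * (2 * l * R - l ^ 2 * (p + q)) ≤ p * x ^ 2 + q * y ^ 2 := by
  rcases (add_nonneg hp hq).eq_or_lt with h | h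
  · have hp0 : p = 0 := by linarith
    have hq0 : q = 0 := by linarith
    subst hp0; subst hq0
    have : R = 0 := by simpa using hR
    subst this; simp
  · have h1 : (p + q) * (2 * l * R - l ^ 2 * (p + q)) ≤ p * q := by
      nlinarith [sq_nonneg (R - l * (p + q))]
    have h2 : (x - y) ^ 2 * ((p + q) * (2 * l * R - l ^ 2 * (p + q))) ≤ (x - y) ^ 2 * (p * q) :=
      mul_le_mul_of_nonneg_left h1 (sq_nonneg _)
    have h3 : (x - y) ^ 2 * (p * q) ≤ (p + q) * (p * x ^ 2 + q * y ^ 2) := by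
      nlinarith [sq_nonneg (p * x + q * y)]
    refine le_of_mul_le_mul_left ?_ h
    linarith

lemma aux_sum_pow {d n : ℕ} (r : Fin d → ℝ) :
    ∑ x : Fin n → Fin d, ∏ k, r (x k) = (∑ i, r i) ^ n := by
  have h := Finset.prod_univ_sum (fun _ : Fin n => (Finset.univ : Finset (Fin d)))
    (fun _ i => r i)
  simpa using h.symm

lemma aux_lecam {d n : ℕ} (p q r : Fin d → ℝ) (hp : IsProbVec p) (hq : IsProbVec q)
    (hr : ∀ i, r i ^ 2 = p i * q i) (est : (Fin n → Fin d) → (Fin d → ℝ)) :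
    sqDist p q * ((∑ i, r i) ^ 2) ^ n / 2 ≤
      expect p (fun x => sqDist p (est x)) + expect q (fun x => sqDist q (est x)) := by
  set ρ := ∑ i, r i with hρ
  set l := ρ ^ n / 2 with hl
  have key : ∀ x : Fin n → Fin d,
      sqDist p q * (2 * l * (∏ k, r (x k)) - l ^ 2 * (prodProb p x + prodProb q x)) ≤
      prodProb p x * sqDist p (est x) + prodProb q x * sqDist q (est x) := by
    intro x
    unfold sqDist
    rw [Finset.sum_mul, Finset.mul_sum, Finset.mul_sum, ← Finset.sum_add_distrib]
    apply Finset.sum_le_sum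
    intro i _
    have := aux_pt (prodProb p x) (prodProb q x) (∏ k, r (x k)) l (p i - est x i) (q i - est x i)
      (Finset.prod_nonneg fun k _ => hp.1 _) (Finset.prod_nonneg fun k _ => hq.1 _)
      (by unfold prodProb; rw [← Finset.prod_pow, ← Finset.prod_mul_distrib]
          exact Finset.prod_congr rfl fun k _ => hr _)
    simpa using this
  have hs := Finset.sum_le_sum (fun x (_ : x ∈ (Finset.univ : Finset (Fin n → Fin d))) => key x)
  rw [Finset.sum_add_distrib, ← Finset.mul_sum, Finset.sum_sub_distrib, ← Finset.mul_sum,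
    ← Finset.mul_sum, Finset.sum_add_distrib] at hs
  have e1 : ∑ x : Fin n → Fin d, prodProb p x = 1 := by
    unfold prodProb; rw [aux_sum_pow, hp.2, one_pow]
  have e2 : ∑ x : Fin n → Fin d, prodProb q x = 1 := by
    unfold prodProb; rw [aux_sum_pow, hq.2, one_pow]
  rw [aux_sum_pow, e1, e2, ← hρ] at hs
  unfold _root_.expect
  refine le_trans (le_of_eq ?_) hs
  rw [← pow_mul, mul_comm 2 n, pow_mul, hl]
  ring

lemma aux_ite {d : ℕ} (π0 : Fin d → ℝ) (h : ∑ i, π0 i = 1) (j : Fin d) (A c : ℝ) :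
    ∑ i, (if i = j then A else c * π0 i) = A + c * (1 - π0 j) := by
  have h1 : ∀ i, (if i = j then A else c * π0 i)
      = c * π0 i + (if i = j then A - c * π0 j else 0) := by
    intro i; split_ifs with hi
    · subst hi; ring
    · ring
  simp_rw [h1]
  rw [Finset.sum_add_distrib, ← Finset.mul_sum, h]
  simp; ring

/-- The family of distributions obtained by moving towards a vertex. -/
noncomputable def fam {d : ℕ} (π0 : Fin d → ℝ) (j : Fin d) (s : ℝ) : Fin d → ℝ :=
  fun i => if i = j then s else (1 - s) / (1 - π0 j) * π0 i

lemma fam_prob {d : ℕ} (π0 : Fin d → ℝ) (h : IsProbVec π0) (j : Fin d) (hj : π0 j ≤ 1 / 2)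
    (s : ℝ) (hs0 : 0 ≤ s) (hs1 : s ≤ 1) : IsProbVec (fam π0 j s) := by
  constructor
  · intro i
    unfold fam
    split_ifs
    · exact hs0
    · exact mul_nonneg (div_nonneg (by linarith) (by linarith)) (h.1 i)
  · unfold fam
    rw [aux_ite π0 h.2]
    have : 1 - π0 j ≠ 0 := by linarith
    field_simp; ring

lemma fam_dist {d : ℕ} (π0 : Fin d → ℝ) (h : IsProbVec π0) (j : Fin d) (hj : π0 j ≤ 1 / 2)
    (s Δ : ℝ) (hs0 : π0 j ≤ s) (hs1 : s ≤ π0 j + Δ / 3) (hΔ : 0 < Δ) :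
    l2norm (fun i => fam π0 j s i - π0 i) ≤ Δ := by
  unfold l2norm
  apply Real.sqrt_le_iff.2 ⟨hΔ.le, ?_⟩
  have hne : 1 - π0 j ≠ 0 := by linarith
  have hb : ∀ i, (fam π0 j s i - π0 i) ^ 2 ≤
      (if i = j then (s - π0 j) ^ 2 else ((s - π0 j) ^ 2 / (1 - π0 j)) * π0 i) := by
    intro i
    unfold fam
    split_ifs with hi
    · subst hi; exact le_rfl
    · have hle : π0 i ≤ 1 - π0 j := by
        have := Finset.add_le_sum (f := π0) (s := Finset.univ) (fun k _ => h.1 k)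
          (Finset.mem_univ i) (Finset.mem_univ j) hi
        rw [h.2] at this; linarith
      have e : (1 - s) / (1 - π0 j) * π0 i - π0 i = -((s - π0 j) / (1 - π0 j) * π0 i) := by
        field_simp; ring
      have e2 : ((s - π0 j) ^ 2 / (1 - π0 j)) * π0 i
        = ((s - π0 j) / (1 - π0 j)) ^ 2 * ((1 - π0 j) * π0 i) := by
        field_simp
      rw [e, e2, neg_sq, mul_pow]
      apply mul_le_mul_of_nonneg_left _ (sq_nonneg _)
      rw [sq]
      exact mul_le_mul_of_nonneg_right hle (h.1 i)
  refine le_trans (Finset.sum_le_sum fun i _ => hb i) ?_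
  rw [aux_ite π0 h.2, div_mul_cancel₀ _ hne]
  nlinarith

lemma aux_bc (s0 s1 : ℝ) (h0 : 0 ≤ s0) (h01 : s0 ≤ s1) (h1 : s1 ≤ 1) (D : ℝ) (hD : 0 < D)
    (hD1 : D ≤ s1 * (1 - s1)) :
    1 - (s1 - s0) ^ 2 / D ≤ (√s0 * √s1 + √(1 - s0) * √(1 - s1)) ^ 2 := by
  have a0 := Real.sq_sqrt h0
  have a1 := Real.sq_sqrt (h0.trans h01)
  have b0 := Real.sq_sqrt (show 0 ≤ 1 - s0 by linarith)
  have b1 := Real.sq_sqrt (show 0 ≤ 1 - s1 by linarith)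
  have p0 := Real.sqrt_nonneg s0
  have p1 := Real.sqrt_nonneg s1
  have p2 := Real.sqrt_nonneg (1 - s0)
  have p3 := Real.sqrt_nonneg (1 - s1)
  set A := √s0
  set B := √s1
  set C := √(1 - s0)
  set E := √(1 - s1)
  have hid : (A * B + C * E) ^ 2 = 1 - (A * E - B * C) ^ 2 := by
    have : (A * B + C * E) ^ 2 + (A * E - B * C) ^ 2 = (A ^ 2 + C ^ 2) * (B ^ 2 + E ^ 2) := by ring
    rw [a0, a1, b0, b1] at this
    linarith
  rw [hid]
  have h2 : (A * E - B * C) ^ 2 * (A * E + B * C) ^ 2 = (s1 - s0) ^ 2 := by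
    have : (A * E - B * C) ^ 2 * (A * E + B * C) ^ 2 = (A ^ 2 * E ^ 2 - B ^ 2 * C ^ 2) ^ 2 := by ring
    rw [this, a0, a1, b0, b1]; ring
  have h3 : D ≤ (A * E + B * C) ^ 2 := by
    have h4 : B ^ 2 * C ^ 2 ≤ (A * E + B * C) ^ 2 := by
      have : 0 ≤ (A * E) * (B * C) := by positivity
      nlinarith [sq_nonneg (A * E)]
    rw [a1, b0] at h4
    nlinarith
  have h5 : (A * E - B * C) ^ 2 ≤ (s1 - s0) ^ 2 / D := by
    rw [le_div_iff₀ hD, ← h2]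
    exact mul_le_mul_of_nonneg_left h3 (sq_nonneg _)
  linarith

/-- Minimax lower bound via Le Cam: for every estimator there is a
π ∈ B(π⁰,Δ) whose risk is at least min(Δ²/32, Δ/(100n))·e^{−4/5}. -/
theorem stmt_4 {d n : ℕ} (hd : 2 ≤ d) (hn : 1 ≤ n)
    (π0 : Fin d → ℝ) (hπ0 : IsProbVec π0)
    (Δ : ℝ) (hΔpos : 0 < Δ) (hΔle : Δ ≤ 1)
    (est : (Fin n → Fin d) → (Fin d → ℝ)) :
    ∃ π : Fin d → ℝ, IsProbVec π ∧ l2norm (fun i => π i - π0 i) ≤ Δ ∧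
      min (Δ ^ 2 / 32) (Δ / (100 * n)) * Real.exp (-(4 / 5)) ≤
        expect π (fun x : Fin n → Fin d => sqDist π (est x)) := by
  obtain ⟨j, hj⟩ : ∃ j, π0 j ≤ 1 / 2 := by
    by_contra! hcon
    have := Finset.add_le_sum (f := π0) (s := Finset.univ) (fun k _ => hπ0.1 k)
      (Finset.mem_univ (⟨0, by omega⟩ : Fin d)) (Finset.mem_univ (⟨1, by omega⟩ : Fin d))
      (by simp)
    rw [hπ0.2] at this
    linarith [hcon ⟨0, by omega⟩, hcon ⟨1, by omega⟩]
  have ha0 := hπ0.1 j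
  have hnpos : (0 : ℝ) < n := by exact_mod_cast hn
  set M := min (Δ ^ 2 / 9) (Δ / (25 * n)) with hM
  have hMpos : 0 < M := lt_min (by positivity) (by positivity)
  set δ := √M with hδ
  have hδ2 : δ ^ 2 = M := Real.sq_sqrt hMpos.le
  have hδ0 : 0 ≤ δ := Real.sqrt_nonneg _
  have hδle : δ ≤ Δ / 3 := by
    apply Real.sqrt_le_iff.2 ⟨by positivity, ?_⟩
    exact (min_le_left _ _).trans (by ring_nf; exact le_rfl)
  set s1 := π0 j + Δ / 3 with hs1
  set s0 := s1 - δ with hs0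
  have hs1le : s1 ≤ 1 := by linarith
  have hs0ge : π0 j ≤ s0 := by linarith
  have P0 := fam_prob π0 hπ0 j hj s0 (by linarith) (by linarith)
  have P1 := fam_prob π0 hπ0 j hj s1 (by linarith) (by linarith)
  have D0 := fam_dist π0 hπ0 j hj s0 Δ (by linarith) (by linarith) hΔpos
  have D1 := fam_dist π0 hπ0 j hj s1 Δ (by linarith) (by linarith) hΔpos
  have hne : 1 - π0 j ≠ 0 := by linarith
  have hLC := aux_lecam (fam π0 j s0) (fam π0 j s1)
    (fun i => if i = j then √s0 * √s1 else √(1 - s0) * √(1 - s1) / (1 - π0 j) * π0 i) P0 P1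
    (by
      intro i
      unfold fam
      split_ifs
      · rw [mul_pow, Real.sq_sqrt (by linarith), Real.sq_sqrt (by linarith)]
      · rw [mul_pow, div_pow, mul_pow, Real.sq_sqrt (by linarith), Real.sq_sqrt (by linarith)]
        field_simp) est
  rw [aux_ite π0 hπ0.2, div_mul_cancel₀ _ hne] at hLC
  have hbc := aux_bc s0 s1 (by linarith) (by linarith) hs1le (5 * Δ / 36) (by positivity)
    (by rw [hs1]; nlinarith [mul_nonneg ha0 (sub_nonneg.2 hj), mul_nonneg ha0 hΔpos.le,
          mul_nonneg (sub_nonneg.2 hj) hΔpos.le, mul_nonneg hΔpos.le (sub_nonneg.2 hΔle)])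
  set ρ := √s0 * √s1 + √(1 - s0) * √(1 - s1)
  have hdd : s1 - s0 = δ := by rw [hs0]; ring
  rw [hdd, hδ2] at hbc
  set u := M / (5 * Δ / 36) with hu
  have hu0 : 0 ≤ u := by positivity
  have hnu : n * u ≤ 36 / 125 := by
    have : M ≤ Δ / (25 * n) := min_le_right _ _
    rw [le_div_iff₀ (by positivity)] at this
    rw [hu, ← mul_div_assoc, div_le_iff₀ (by positivity)]
    linarith
  have hu1 : u ≤ 1 := by
    have : (1 : ℝ) ≤ n := by exact_mod_cast hn
    nlinarith
  have hpow : 89 / 125 ≤ (ρ ^ 2) ^ n := by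
    have h1 := one_add_mul_le_pow (show (-2 : ℝ) ≤ -u by linarith) n
    have h2 : (1 + -u) ^ n ≤ (ρ ^ 2) ^ n := pow_le_pow_left₀ (by linarith) (by linarith) n
    linarith
  have hS : M ≤ sqDist (fam π0 j s0) (fam π0 j s1) := by
    unfold sqDist
    have := Finset.single_le_sum (f := fun i => (fam π0 j s0 i - fam π0 j s1 i) ^ 2)
      (fun i _ => sq_nonneg _) (Finset.mem_univ j)
    refine le_trans (le_of_eq ?_) this
    simp only [fam, if_true]
    rw [← hδ2, hs0]; ring
  have hexp : Real.exp (-(4 / 5)) ≤ 1 / 2 := by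
    rw [Real.exp_neg, inv_le_comm₀ (Real.exp_pos _) (by norm_num)]
    have := Real.quadratic_le_exp_of_nonneg (show (0 : ℝ) ≤ 4 / 5 by norm_num)
    norm_num at this ⊢
    linarith
  set m := min (Δ ^ 2 / 32) (Δ / (100 * n)) with hm
  have hm0 : 0 ≤ m := le_min (by positivity) (by positivity)
  have hmM : m * (32 / 9) ≤ M := by
    apply le_min
    · have : m ≤ Δ ^ 2 / 32 := min_le_left _ _
      linarith
    · have : m ≤ Δ / (100 * n) := min_le_right _ _
      have e : Δ / (25 * n) = 4 * (Δ / (100 * n)) := by field_simp; norm_num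
      rw [e]; linarith
  have hfin : m * Real.exp (-(4 / 5)) ≤ m * (1 / 2) := mul_le_mul_of_nonneg_left hexp hm0
  have hprod : M * (89 / 125) ≤ sqDist (fam π0 j s0) (fam π0 j s1) * (ρ ^ 2) ^ n :=
    mul_le_mul hS hpow (by norm_num) (hMpos.le.trans hS)
  by_cases hc : m * Real.exp (-(4 / 5)) ≤
      expect (fam π0 j s0) (fun x : Fin n → Fin d => sqDist (fam π0 j s0) (est x))
  · exact ⟨_, P0, D0, hc⟩
  · refine ⟨_, P1, D1, ?_⟩
    push Not at hc
    linarith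
end

section
/- Let d ≥ 2, let π⁰ be a probability vector on [d], and let 0 < Δ ≤ 1. Then there exists a probability vector π' on [d] such that (1) ‖π' − π⁰‖² ≤ Δ²/2, and (2) there exist two distinct indices i, j ∈ [d] with π'_i ≥ Δ/√12 and π'_j ≥ Δ/√12. -/
open Finset

/-- Mass rearrangement: there is a probability vector π' with
‖π' − π⁰‖² ≤ Δ²/2 and two distinct coordinates both at least Δ/√12. -/
theorem stmt_5 {d : ℕ} (hd : 2 ≤ d)
    (π0 : Fin d → ℝ) (hπ0 : IsProbVec π0)
    (Δ : ℝ) (hΔpos : 0 < Δ) (hΔle : Δ ≤ 1) :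
    ∃ π' : Fin d → ℝ, IsProbVec π' ∧ sqDist π' π0 ≤ Δ ^ 2 / 2 ∧
      ∃ i j : Fin d, i ≠ j ∧ Δ / Real.sqrt 12 ≤ π' i ∧ Δ / Real.sqrt 12 ≤ π' j := by
  obtain ⟨hnn, hsum⟩ := hπ0
  set t : ℝ := Δ / Real.sqrt 12 with ht
  have hs : (0:ℝ) < Real.sqrt 12 := Real.sqrt_pos.mpr (by norm_num)
  have ht0 : 0 < t := div_pos hΔpos hs
  have ht2 : t ^ 2 = Δ ^ 2 / 12 := by
    rw [ht, div_pow, Real.sq_sqrt (by norm_num)]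
  have ht1 : 2 * t ≤ 1 := by nlinarith
  have hle : ∀ k, π0 k ≤ 1 := fun k => by
    rw [← hsum]
    exact Finset.single_le_sum (fun i _ => hnn i) (Finset.mem_univ k)
  let i : Fin d := ⟨0, by omega⟩
  let j : Fin d := ⟨1, by omega⟩
  have hij : i ≠ j := by simp [i, j]
  obtain ⟨u, hu0, hui, huj, husq, husum⟩ : ∃ u : Fin d → ℝ, (∀ k, 0 ≤ u k) ∧ u i = 1/2 ∧
      u j = 1/2 ∧ (∀ k, u k ^ 2 = u k / 2) ∧ ∑ k, u k = 1 := by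
    refine ⟨fun k => (if k = i then 1/2 else 0) + (if k = j then 1/2 else 0), ?_, ?_, ?_, ?_, ?_⟩
    · intro k
      positivity
    · simp [hij]
    · simp [hij.symm]
    · intro k
      by_cases h1 : k = i
      · subst h1
        simp only [if_neg hij, if_true]
        norm_num
      · by_cases h2 : k = j <;> simp only [h1, h2, hij.symm, if_true, if_false] <;> norm_num
    · rw [Finset.sum_add_distrib]
      simp only [Finset.sum_ite_eq', Finset.mem_univ, if_true]
      norm_num
  refine ⟨fun k => (1 - 2 * t) * π0 k + 2 * t * u k, ⟨?_, ?_⟩, ?_, i, j, hij, ?_, ?_⟩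
  · intro k
    have := mul_nonneg (sub_nonneg.mpr ht1) (hnn k)
    have := mul_nonneg ht0.le (hu0 k)
    linarith
  · rw [Finset.sum_add_distrib, ← Finset.mul_sum, ← Finset.mul_sum, hsum, husum]
    ring
  · have h1 : sqDist (fun k => (1 - 2 * t) * π0 k + 2 * t * u k) π0
        ≤ ∑ k, 4 * t ^ 2 * (π0 k + u k / 2) := by
      unfold sqDist
      refine Finset.sum_le_sum fun k _ => ?_
      have e : ((1 - 2 * t) * π0 k + 2 * t * u k - π0 k) ^ 2
          = 4 * t ^ 2 * (u k - π0 k) ^ 2 := by ring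
      rw [e]
      refine mul_le_mul_of_nonneg_left ?_ (by positivity)
      have a1 := mul_nonneg (hnn k) (hu0 k)
      have a2 := mul_nonneg (hnn k) (sub_nonneg.mpr (hle k))
      have a3 := husq k
      nlinarith
    rw [← Finset.mul_sum, Finset.sum_add_distrib, ← Finset.sum_div, hsum, husum, ht2] at h1
    linarith
  · have := mul_nonneg (sub_nonneg.mpr ht1) (hnn i)
    simp only [hui]
    linarith
  · have := mul_nonneg (sub_nonneg.mpr ht1) (hnn j)
    simp only [huj]
    linarith
end

section
/- Let p be a probability vector on [d], let i ≠ j be indices, and let 0 < τ < min(p_i, p_j). Define the probability vectors π⁺ = p + τ(e_i − e_j) and π⁻ = p − τ(e_i − e_j), where e_k is the k-th standard basis vector. Then the Kullback–Leibler divergence satisfies D_KL(π⁺ ‖ π⁻) ≤ 4τ² · ( 1/(p_i − τ) + 1/(p_j − τ) ). -/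
open Finset

/-- KL divergence over the support of P: Σ_{k : P k > 0} P k · log(P k / Q k). -/
noncomputable def klDiv {d : ℕ} (P Q : Fin d → ℝ) : ℝ :=
  ∑ k ∈ Finset.univ.filter (fun k => 0 < P k), P k * Real.log (P k / Q k)

/-- With π⁺ = p + τ(e_i − e_j) and π⁻ = p − τ(e_i − e_j), where 0 < τ < min(p_i, p_j),
D_KL(π⁺‖π⁻) ≤ 4τ²·(1/(p_i−τ) + 1/(p_j−τ)). -/
theorem stmt_6 {d : ℕ} (p : Fin d → ℝ) (hp : IsProbVec p)
    (i j : Fin d) (hij : i ≠ j)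
    (τ : ℝ) (hτpos : 0 < τ) (hτlt : τ < min (p i) (p j)) :
    klDiv (fun k => if k = i then p k + τ else if k = j then p k - τ else p k)
          (fun k => if k = i then p k - τ else if k = j then p k + τ else p k) ≤
      4 * τ ^ 2 * (1 / (p i - τ) + 1 / (p j - τ)) := by
  obtain ⟨h1, h2⟩ := lt_min_iff.mp hτlt
  have key : ∀ x y : ℝ, 0 < x → 0 < y → x * Real.log (x / y) ≤ (x - y) + (x - y) ^ 2 / y := by
    intro x y hx hy
    have h := Real.log_le_sub_one_of_pos (div_pos hx hy)
    have h' := mul_le_mul_of_nonneg_left h hx.le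
    have e : x * (x / y - 1) = (x - y) + (x - y) ^ 2 / y := by
      field_simp
      ring
    linarith
  have hA := key (p i + τ) (p i - τ) (by linarith) (by linarith)
  have hB := key (p j - τ) (p j + τ) (by linarith) (by linarith)
  have hC : (p j - τ - (p j + τ)) ^ 2 / (p j + τ) ≤ (p j - τ - (p j + τ)) ^ 2 / (p j - τ) := by
    apply div_le_div_of_nonneg_left (sq_nonneg _) <;> linarith
  unfold klDiv
  rw [Finset.sum_filter]
  calc _ ≤ ∑ k, ((if k = i then (p i + τ) * Real.log ((p i + τ) / (p i - τ)) else 0)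
        + (if k = j then (p j - τ) * Real.log ((p j - τ) / (p j + τ)) else 0)) := by
        apply Finset.sum_le_sum
        intro k _
        by_cases hki : k = i
        · subst hki
          have : 0 < p k + τ := by linarith
          simp [hij, this]
        · by_cases hkj : k = j
          · subst hkj
            simp [hki, h2]
          · by_cases h0 : 0 < p k
            · simp [hki, hkj, h0, div_self h0.ne']
            · simp [hki, hkj, h0]
    _ = (p i + τ) * Real.log ((p i + τ) / (p i - τ))
        + (p j - τ) * Real.log ((p j - τ) / (p j + τ)) := by
        rw [Finset.sum_add_distrib]
        simp
    _ ≤ (p i + τ - (p i - τ)) ^ 2 / (p i - τ) + (p j - τ - (p j + τ)) ^ 2 / (p j - τ) := by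
        linarith
    _ = _ := by ring
end

section
/- Let d ≥ 2 be an even integer, let n ≥ d, let 0 < Δ ≤ 1, and let Unif[d] = (1/d, …, 1/d). Then for every estimator π̂ : [d]^n → ℝ^d there exists a probability vector π ∈ B(Unif[d], Δ) with E[‖π − π̂(X^n)‖²] ≥ min( Δ², 1/n ) · e^{−2}/8. -/
open Finset

lemma aux_A {d n : ℕ} (hn : 0 < n) (p q s : Fin d → ℝ) (hp : ∀ i, 0 < p i) (hq : ∀ i, 0 < q i)
    (hs : ∀ i, 0 ≤ s i) (hpq : ∀ i, s i ^ 2 ≤ p i * q i) (hp1 : ∑ i, p i = 1)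
    (hq1 : ∑ i, q i = 1) (hs1 : 1 - 1 / (2 * n) ≤ ∑ i, s i) :
    1 / 8 ≤ ∑ x : Fin n → Fin d,
      prodProb p x * prodProb q x / (prodProb p x + prodProb q x) := by
  have hP : ∀ x : Fin n → Fin d, 0 < prodProb p x := fun x => prod_pos fun k _ => hp _
  have hQ : ∀ x : Fin n → Fin d, 0 < prodProb q x := fun x => prod_pos fun k _ => hq _
  have tot : ∀ f : Fin d → ℝ, ∑ x : Fin n → Fin d, prodProb f x = (∑ i, f i) ^ n := by
    intro f
    simp only [prodProb]
    rw [Fintype.sum_pow]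
  have hS : ∀ x : Fin n → Fin d, prodProb s x ^ 2 ≤ prodProb p x * prodProb q x := by
    intro x
    simp only [prodProb]
    rw [← prod_pow, ← prod_mul_distrib]
    exact prod_le_prod (fun _ _ => sq_nonneg _) fun _ _ => hpq _
  have hn' : (1 : ℝ) ≤ n := by exact_mod_cast hn
  have hber : (1 : ℝ) / 2 ≤ (∑ i, s i) ^ n := by
    have h1 : (1 : ℝ) / (2 * n) ≤ 1 / 2 := by
      rw [div_le_div_iff₀ (by positivity) (by positivity)]; linarith
    have h := one_add_mul_le_pow (a := -(1 / (2 * (n : ℝ)))) (by linarith) n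
    have h2 : 1 + (n : ℝ) * -(1 / (2 * n)) = 1 / 2 := by field_simp; norm_num
    rw [h2] at h
    exact h.trans (pow_le_pow_left₀ (by linarith) (by linarith) n)
  have cs := sum_sq_le_sum_mul_sum_of_sq_eq_mul (univ : Finset (Fin n → Fin d))
    (r := fun x => prodProb s x)
    (f := fun x => prodProb s x ^ 2 / (prodProb p x + prodProb q x))
    (g := fun x => prodProb p x + prodProb q x)
    (fun x _ => div_nonneg (sq_nonneg _) (add_pos (hP x) (hQ x)).le)
    (fun x _ => (add_pos (hP x) (hQ x)).le)
    (fun x _ => by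
      have := (add_pos (hP x) (hQ x)).ne'
      field_simp)
  rw [sum_add_distrib, tot, tot, tot, hp1, hq1] at cs
  have hle : ∑ x : Fin n → Fin d, prodProb s x ^ 2 / (prodProb p x + prodProb q x) ≤
      ∑ x : Fin n → Fin d, prodProb p x * prodProb q x / (prodProb p x + prodProb q x) :=
    sum_le_sum fun x _ => div_le_div_of_nonneg_right (hS x) (add_pos (hP x) (hQ x)).le
  simp only [one_pow] at cs
  nlinarith

lemma aux_pt_s7 (P Q a b t : ℝ) (hP : 0 < P) (hQ : 0 < Q) :
    P * Q / (P + Q) * (a - b) ^ 2 ≤ P * (a - t) ^ 2 + Q * (b - t) ^ 2 := by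
  have h : 0 < P + Q := add_pos hP hQ
  rw [div_mul_eq_mul_div, div_le_iff₀ h]
  nlinarith [sq_nonneg (P * (a - t) + Q * (b - t))]

def sgnB (δ : ℝ) (b : Bool) : ℝ := bif b then δ else -δ

noncomputable def pv (m : ℕ) (δ : ℝ) (v : Fin m → Bool) : Fin (m + m) → ℝ :=
  Fin.append (fun j => 1 / ((m + m : ℕ) : ℝ) + sgnB δ (v j))
    (fun j => 1 / ((m + m : ℕ) : ℝ) - sgnB δ (v j))

lemma sgnB_sq (δ : ℝ) (b : Bool) : sgnB δ b ^ 2 = δ ^ 2 := by cases b <;> simp [sgnB]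
lemma sgnB_not (δ : ℝ) (b : Bool) : sgnB δ (!b) = - sgnB δ b := by cases b <;> simp [sgnB]

lemma pv_sum {m : ℕ} (hm : 0 < m) (δ : ℝ) (v : Fin m → Bool) : ∑ i, pv m δ v i = 1 := by
  rw [Fin.sum_univ_add]
  simp only [pv, Fin.append_left, Fin.append_right]
  rw [← sum_add_distrib]
  have : (m : ℝ) ≠ 0 := by positivity
  simp
  field_simp

lemma pv_pos {m : ℕ} {δ : ℝ} (h0 : 0 ≤ δ) (h : δ < 1 / ((m + m : ℕ) : ℝ)) (v : Fin m → Bool)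
    (i : Fin (m + m)) : 0 < pv m δ v i := by
  have : ∀ b, -δ ≤ sgnB δ b ∧ sgnB δ b ≤ δ := by
    intro b; cases b <;> simp [sgnB] <;> linarith
  refine Fin.addCases (fun j => ?_) (fun j => ?_) i
  · simp only [pv, Fin.append_left]; linarith [(this (v j)).1]
  · simp only [pv, Fin.append_right]; linarith [(this (v j)).2]

def flipB {m : ℕ} (j : Fin m) (v : Fin m → Bool) : Fin m → Bool := Function.update v j (!v j)

lemma flipB_inv {m : ℕ} (j : Fin m) : Function.Involutive (flipB j) := by
  intro v
  simp [flipB]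

/-- the part of the risk from the pair `j`. -/
noncomputable def term {m n : ℕ} (δ : ℝ) (est : (Fin n → Fin (m + m)) → (Fin (m + m) → ℝ))
    (j : Fin m) (v : Fin m → Bool) : ℝ :=
  ∑ x, prodProb (pv m δ v) x * ((pv m δ v (Fin.castAdd m j) - est x (Fin.castAdd m j)) ^ 2 +
    (pv m δ v (Fin.natAdd m j) - est x (Fin.natAdd m j)) ^ 2)

lemma risk_eq {m n : ℕ} (δ : ℝ) (est : (Fin n → Fin (m + m)) → (Fin (m + m) → ℝ))
    (v : Fin m → Bool) :
    expect (pv m δ v) (fun x => sqDist (pv m δ v) (est x)) = ∑ j, term δ est j v := by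
  simp only [_root_.expect, sqDist, term]
  rw [sum_comm]
  refine sum_congr rfl fun x _ => ?_
  rw [Fin.sum_univ_add, ← sum_add_distrib, mul_sum]

lemma term_pair {m n : ℕ} (hn0 : 0 < n) (hm : 0 < m) {δ : ℝ} (h0 : 0 ≤ δ)
    (h : δ ≤ 1 / (2 * ((m + m : ℕ) : ℝ))) (hn : ((m + m : ℕ) : ℝ) * δ ^ 2 ≤ 1 / (4 * n))
    (est : (Fin n → Fin (m + m)) → (Fin (m + m) → ℝ)) (j : Fin m) (v : Fin m → Bool) :
    δ ^ 2 ≤ term δ est j v + term δ est j (flipB j v) := by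
  have hD : (0 : ℝ) < ((m + m : ℕ) : ℝ) := by positivity
  have hlt : δ < 1 / ((m + m : ℕ) : ℝ) := by
    refine h.trans_lt ?_
    rw [div_lt_div_iff₀ (by positivity) (by positivity)]; linarith
  have hpp := pv_pos h0 hlt v
  have hqp := pv_pos h0 hlt (flipB j v)
  have hDδ : ((m + m : ℕ) : ℝ) * δ ≤ 1 / 2 := by
    rw [le_div_iff₀ (by positivity)] at h; linarith
  have key : 1 / 8 ≤ ∑ x : Fin n → Fin (m + m),
      prodProb (pv m δ v) x * prodProb (pv m δ (flipB j v)) x /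
        (prodProb (pv m δ v) x + prodProb (pv m δ (flipB j v)) x) := by
    set u : ℝ := 1 / ((m + m : ℕ) : ℝ) - ((m + m : ℕ) : ℝ) * δ ^ 2 with hu
    have hu0 : 0 ≤ u := by
      have : ((m + m : ℕ) : ℝ) * δ ^ 2 ≤ 1 / 2 * δ := by nlinarith
      linarith
    have hu2 : u ^ 2 ≤ (1 / ((m + m : ℕ) : ℝ)) ^ 2 - δ ^ 2 := by
      have e : u ^ 2 = (1 / ((m + m : ℕ) : ℝ)) ^ 2 - 2 * δ ^ 2
          + (((m + m : ℕ) : ℝ) * δ) ^ 2 * δ ^ 2 := by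
        rw [hu]; field_simp; ring
      have : (((m + m : ℕ) : ℝ) * δ) ^ 2 ≤ 1 := by
        have : 0 ≤ ((m + m : ℕ) : ℝ) * δ := by positivity
        nlinarith
      rw [e]; nlinarith [sq_nonneg δ]
    have hsame : ∀ k, k ≠ j → flipB j v k = v k := fun k hk => by simp [flipB, hk]
    have hj : flipB j v j = !v j := by simp [flipB]
    refine aux_A hn0 _ _ (Fin.append
      (fun k => if k = j then u else pv m δ v (Fin.castAdd m k))
      (fun k => if k = j then u else pv m δ v (Fin.natAdd m k))) hpp hqp ?_ ?_
      (pv_sum hm _ _) (pv_sum hm _ _) ?_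
    · intro i
      refine Fin.addCases (fun k => ?_) (fun k => ?_) i
      · simp only [Fin.append_left]; split_ifs; exacts [hu0, (hpp _).le]
      · simp only [Fin.append_right]; split_ifs; exacts [hu0, (hpp _).le]
    · intro i
      refine Fin.addCases (fun k => ?_) (fun k => ?_) i
      · simp only [Fin.append_left, pv]
        split_ifs with hk
        · subst hk
          rw [hj, sgnB_not]
          nlinarith [sgnB_sq δ (v k)]
        · rw [hsame k hk, sq]
      · simp only [Fin.append_right, pv]
        split_ifs with hk
        · subst hk
          rw [hj, sgnB_not]
          nlinarith [sgnB_sq δ (v k)]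
        · rw [hsame k hk, sq]
    · have hs : ∀ f : Fin m → ℝ, ∑ k, (if k = j then u else f k) = ∑ k, f k + (u - f j) := by
        intro f
        have : ∀ k, (if k = j then u else f k) = f k + (if k = j then u - f j else 0) := by
          intro k; split_ifs with hk
          · subst hk; ring
          · ring
        simp only [this, sum_add_distrib, sum_ite_eq', mem_univ, if_true]
      have h1 := pv_sum hm δ v
      rw [Fin.sum_univ_add] at h1 ⊢
      simp only [Fin.append_left, Fin.append_right]
      rw [hs, hs]
      have h2 : pv m δ v (Fin.castAdd m j) + pv m δ v (Fin.natAdd m j)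
          = 2 * (1 / ((m + m : ℕ) : ℝ)) := by
        simp only [pv, Fin.append_left, Fin.append_right]; ring
      have h3 : (1 : ℝ) / (2 * n) = 2 * (1 / (4 * n)) := by
        field_simp; norm_num
      rw [h3]
      linarith
  have h8 : 8 * δ ^ 2 * ∑ x : Fin n → Fin (m + m),
      prodProb (pv m δ v) x * prodProb (pv m δ (flipB j v)) x /
        (prodProb (pv m δ v) x + prodProb (pv m δ (flipB j v)) x) ≤
      term δ est j v + term δ est j (flipB j v) := by
    simp only [term]
    rw [mul_sum, ← sum_add_distrib]
    refine sum_le_sum fun x _ => ?_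
    have hP : 0 < prodProb (pv m δ v) x := prod_pos fun k _ => hpp _
    have hQ : 0 < prodProb (pv m δ (flipB j v)) x := prod_pos fun k _ => hqp _
    have a1 := aux_pt_s7 _ _ (pv m δ v (Fin.castAdd m j)) (pv m δ (flipB j v) (Fin.castAdd m j))
      (est x (Fin.castAdd m j)) hP hQ
    have a2 := aux_pt_s7 _ _ (pv m δ v (Fin.natAdd m j)) (pv m δ (flipB j v) (Fin.natAdd m j))
      (est x (Fin.natAdd m j)) hP hQ
    have hj : flipB j v j = !v j := by simp [flipB]
    have e1 : (pv m δ v (Fin.castAdd m j) - pv m δ (flipB j v) (Fin.castAdd m j)) ^ 2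
        = 4 * δ ^ 2 := by
      simp only [pv, Fin.append_left]
      rw [hj, sgnB_not, ← sgnB_sq δ (v j)]; ring
    have e2 : (pv m δ v (Fin.natAdd m j) - pv m δ (flipB j v) (Fin.natAdd m j)) ^ 2
        = 4 * δ ^ 2 := by
      simp only [pv, Fin.append_right]
      rw [hj, sgnB_not, ← sgnB_sq δ (v j)]; ring
    rw [e1] at a1
    rw [e2] at a2
    linarith
  nlinarith [sq_nonneg δ]

theorem stmt_7 {d n : ℕ} (hd : 2 ≤ d) (heven : Even d) (hn : d ≤ n)
    (Δ : ℝ) (hΔpos : 0 < Δ) (hΔle : Δ ≤ 1)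
    (est : (Fin n → Fin d) → (Fin d → ℝ)) :
    ∃ π : Fin d → ℝ, IsProbVec π ∧ l2norm (fun i => π i - 1 / d) ≤ Δ ∧
      min (Δ ^ 2) (1 / n) * Real.exp (-2) / 8 ≤
        expect π (fun x : Fin n → Fin d => sqDist π (est x)) := by
  obtain ⟨m, rfl⟩ := heven
  have hm : 0 < m := by omega
  have hn0 : 0 < n := by omega
  have hnr : (0 : ℝ) < n := by exact_mod_cast hn0
  have hD : (0 : ℝ) < ((m + m : ℕ) : ℝ) := by positivity
  have hDn : ((m + m : ℕ) : ℝ) ≤ n := by exact_mod_cast hn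
  set r : ℝ := min (Δ ^ 2) (1 / n) with hr
  have hr0 : 0 ≤ r := le_min (by positivity) (by positivity)
  have hr1 : r ≤ Δ ^ 2 := min_le_left _ _
  have hr2 : r ≤ 1 / n := min_le_right _ _
  obtain ⟨δ, h0, hδ⟩ : ∃ δ : ℝ, 0 ≤ δ ∧ ((m + m : ℕ) : ℝ) * δ ^ 2 = r / 4 :=
    ⟨Real.sqrt (r / (4 * ((m + m : ℕ) : ℝ))), Real.sqrt_nonneg _, by
      rw [Real.sq_sqrt (by positivity)]; field_simp⟩
  have hnδ : ((m + m : ℕ) : ℝ) * δ ^ 2 ≤ 1 / (4 * n) := by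
    rw [hδ]
    have : (1 : ℝ) / (4 * n) = 1 / n / 4 := by field_simp
    linarith
  have h : δ ≤ 1 / (2 * ((m + m : ℕ) : ℝ)) := by
    have h1 : (1 : ℝ) / n ≤ 1 / ((m + m : ℕ) : ℝ) := one_div_le_one_div_of_le hD hDn
    have h2 : ((m + m : ℕ) : ℝ) * (((m + m : ℕ) : ℝ) * δ ^ 2) ≤ 1 / 4 := by
      rw [hδ]
      have : r * ((m + m : ℕ) : ℝ) ≤ 1 := by
        have := hr2.trans h1
        rwa [le_div_iff₀ hD] at this
      linarith
    have h3 : ((m + m : ℕ) : ℝ) * δ ≤ 1 / 2 := by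
      refine (abs_le_of_sq_le_sq' ?_ (by norm_num : (0:ℝ) ≤ 1 / 2)).2
      nlinarith
    rw [le_div_iff₀ (by positivity)]; linarith
  have hlt : δ < 1 / ((m + m : ℕ) : ℝ) := by
    refine h.trans_lt ?_
    rw [div_lt_div_iff₀ (by positivity) (by positivity)]; linarith
  have hsum : (2 : ℝ) ^ m * (m * (δ ^ 2 / 2)) ≤
      ∑ v : Fin m → Bool, expect (pv m δ v) (fun x => sqDist (pv m δ v) (est x)) := by
    simp only [risk_eq]
    rw [sum_comm]
    have : ∀ j : Fin m, (2 : ℝ) ^ m * (δ ^ 2 / 2) ≤ ∑ v, term δ est j v := by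
      intro j
      have e : ∑ v, term δ est j (flipB j v) = ∑ v, term δ est j v :=
        Equiv.sum_comp (flipB_inv j).toPerm (fun v => term δ est j v)
      have l : ∑ _v : Fin m → Bool, δ ^ 2 ≤
          ∑ v, (term δ est j v + term δ est j (flipB j v)) :=
        sum_le_sum fun v _ => term_pair hn0 hm h0 h hnδ est j v
      rw [sum_add_distrib, e] at l
      simp at l
      linarith
    have l := sum_le_sum fun j (_ : j ∈ (univ : Finset (Fin m))) => this j
    simp at l
    linarith
  have hmr : (m : ℝ) * (δ ^ 2 / 2) = r / 16 := by
    push_cast at hδ; linarith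
  rw [hmr] at hsum
  obtain ⟨v, -, hv⟩ : ∃ v ∈ (univ : Finset (Fin m → Bool)), r / 16 ≤
      expect (pv m δ v) (fun x => sqDist (pv m δ v) (est x)) := by
    apply exists_le_of_sum_le univ_nonempty
    simpa using hsum
  refine ⟨pv m δ v, ⟨fun i => (pv_pos h0 hlt v i).le, pv_sum hm δ v⟩, ?_, le_trans ?_ hv⟩
  · rw [l2norm, Real.sqrt_le_left hΔpos.le, Fin.sum_univ_add]
    simp only [pv, Fin.append_left, Fin.append_right]
    simp only [add_sub_cancel_left, sub_sub_cancel_left, neg_sq, sgnB_sq]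
    simp
    push_cast at hδ
    linarith
  · have he : Real.exp (-2) ≤ 1 / 2 := by
      rw [Real.exp_neg, ← one_div]
      exact one_div_le_one_div_of_le (by norm_num) (by linarith [Real.add_one_le_exp (2 : ℝ)])
    nlinarith
end

section
/- Let d = 2m be even and let 0 < τ ≤ 1/(2d). For v ∈ {−1, +1}^m, let θ_v be the probability vector on [d] whose (2k−1)-th coordinate is 1/d + τ·v_k and whose 2k-th coordinate is 1/d − τ·v_k for k = 1,…,m. Then for any v, v' ∈ {−1,+1}^m that differ in exactly one coordinate, D_KL(θ_v ‖ θ_{v'}) ≤ 8dτ². -/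
open Finset

/-- KL divergence between fully supported distributions: Σ_k P k · log(P k / Q k). -/
noncomputable def klFull {d : ℕ} (P Q : Fin d → ℝ) : ℝ :=
  ∑ k, P k * Real.log (P k / Q k)

/-- For v ∈ {−1,+1}^m, θ_v is the vector on [2m] whose (2k−1)-th coordinate (1-indexed, i.e.
even 0-indexed coordinate 2k−2) is 1/d + τ·v_k and whose 2k-th coordinate is 1/d − τ·v_k. -/
noncomputable def thetaV (m : ℕ) (τ : ℝ) (v : Fin m → ℝ) : Fin (2 * m) → ℝ :=
  fun i => 1 / (2 * m : ℝ) +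
    (if i.val % 2 = 0 then τ * v ⟨i.val / 2, by have := i.isLt; omega⟩
     else -(τ * v ⟨i.val / 2, by have := i.isLt; omega⟩))

theorem two_term {a τ d : ℝ} (hτ : 0 < τ) (hd : 0 < d) (h : 1 / (2 * d) ≤ a - τ) :
    (a + τ) * Real.log ((a + τ) / (a - τ)) + (a - τ) * Real.log ((a - τ) / (a + τ))
      ≤ 8 * d * τ ^ 2 := by
  have h0 : 0 < 1 / (2 * d) := by positivity
  have hy : 0 < a - τ := by linarith
  have hx : 0 < a + τ := by linarith
  have e : Real.log ((a - τ) / (a + τ)) = - Real.log ((a + τ) / (a - τ)) := by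
    rw [← Real.log_inv, inv_div]
  have hl : Real.log ((a + τ) / (a - τ)) ≤ 4 * d * τ := by
    refine (Real.log_le_sub_one_of_pos (by positivity)).trans ?_
    rw [div_sub_one hy.ne', div_le_iff₀ hy]
    have h2 : 4 * d * τ * (1 / (2 * d)) = 2 * τ := by field_simp; norm_num
    have := mul_le_mul_of_nonneg_left h (by positivity : 0 ≤ 4 * d * τ)
    linarith
  rw [e]
  have := mul_le_mul_of_nonneg_left hl (by positivity : 0 ≤ 2 * τ)
  nlinarith

/-- For d = 2m even, 0 < τ ≤ 1/(2d), and v, v' ∈ {−1,+1}^m differing in exactly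
one coordinate, D_KL(θ_v ‖ θ_{v'}) ≤ 8dτ². -/
theorem stmt_8 (m : ℕ) (hm : 1 ≤ m)
    (τ : ℝ) (hτpos : 0 < τ) (hτle : τ ≤ 1 / (2 * (2 * m : ℝ)))
    (v v' : Fin m → ℝ) (hv : ∀ k, v k = 1 ∨ v k = -1) (hv' : ∀ k, v' k = 1 ∨ v' k = -1)
    (hdiff : ∃ k₀, v k₀ ≠ v' k₀ ∧ ∀ k, k ≠ k₀ → v k = v' k) :
    klFull (thetaV m τ v) (thetaV m τ v') ≤ 8 * (2 * m : ℝ) * τ ^ 2 := by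
  obtain ⟨k₀, hne, heq⟩ := hdiff
  have hm0 : (0 : ℝ) < m := by exact_mod_cast hm
  have hk := k₀.isLt
  have hb : 1 / (2 * (2 * m : ℝ)) ≤ 1 / (2 * m : ℝ) - τ := by
    have : 1 / (2 * m : ℝ) = 2 * (1 / (2 * (2 * m : ℝ))) := by field_simp
    linarith
  have hpos : 0 < 1 / (2 * (2 * m : ℝ)) := by positivity
  have key := two_term hτpos (by positivity : (0 : ℝ) < 2 * m) hb
  unfold klFull
  rw [Fintype.sum_eq_add (⟨2 * k₀.val, by omega⟩ : Fin (2 * m)) ⟨2 * k₀.val + 1, by omega⟩]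
  · have e0 : ∀ w : Fin m → ℝ, thetaV m τ w ⟨2 * k₀.val, by omega⟩
        = 1 / (2 * m : ℝ) + τ * w k₀ := by
      intro w
      simp [thetaV]
    have e1 : ∀ w : Fin m → ℝ, thetaV m τ w ⟨2 * k₀.val + 1, by omega⟩
        = 1 / (2 * m : ℝ) - τ * w k₀ := by
      intro w
      have h1 : (2 * k₀.val + 1) / 2 = k₀.val := by omega
      have h2 : (2 * k₀.val + 1) % 2 = 1 := by omega
      simp [thetaV, h1, h2, sub_eq_add_neg]
    rw [e0, e0, e1, e1]
    rcases hv k₀ with h | h <;> rcases hv' k₀ with h' | h' <;> rw [h, h'] at hne ⊢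
    · exact absurd rfl hne
    · simpa only [mul_one, mul_neg, ← sub_eq_add_neg, sub_neg_eq_add] using key
    · rw [add_comm]
      simpa only [mul_one, mul_neg, ← sub_eq_add_neg, sub_neg_eq_add] using key
    · exact absurd rfl hne
  · simp [Fin.ext_iff]
  · rintro i ⟨hi0, hi1⟩
    have hlt := i.isLt
    have hik : (⟨i.val / 2, by omega⟩ : Fin m) ≠ k₀ := by
      intro h
      have := congrArg Fin.val h
      simp only [ne_eq, Fin.ext_iff] at hi0 hi1 this
      omega
    have e : thetaV m τ v i = thetaV m τ v' i := by
      simp only [thetaV, heq _ hik]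
    rw [e]
    rcases eq_or_ne (thetaV m τ v' i) 0 with h | h
    · simp [h]
    · simp [div_self h]
end

section
/- Let d ≥ 2 and let π⁰ be a probability vector on [d] with coordinatewise square root θ⁰_i = √(π⁰_i). Then there exists a unit vector g ∈ ℝ^d with ⟨g, θ⁰⟩ = 0 such that Σ_{i=1}^d π⁰_i · g_i² ≥ (1 − ‖π⁰‖²)/(d − 1). -/
open Finset

/-- There is a unit vector g orthogonal to θ⁰ = √π⁰ with
Σ_i π⁰_i g_i² ≥ (1 − ‖π⁰‖²)/(d − 1). -/
theorem stmt_10 {d : ℕ} (hd : 2 ≤ d)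
    (π0 : Fin d → ℝ) (hπ0 : IsProbVec π0) :
    ∃ g : Fin d → ℝ, (∑ i, g i ^ 2 = 1) ∧ (∑ i, g i * Real.sqrt (π0 i) = 0) ∧
      (1 - ∑ i, π0 i ^ 2) / ((d : ℝ) - 1) ≤ ∑ i, π0 i * g i ^ 2 := by
  obtain ⟨h0, h1⟩ := hπ0
  have hd' : (2:ℝ) ≤ d := by exact_mod_cast hd
  have hle : ∀ i, π0 i ≤ 1 := fun i => by
    rw [← h1]; exact Finset.single_le_sum (fun j _ => h0 j) (Finset.mem_univ i)
  obtain ⟨S, hS⟩ : ∃ S, S = ∑ i, π0 i ^ 2 := ⟨_, rfl⟩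
  have hS1 : S ≤ 1 := by
    rw [hS, ← h1]
    exact Finset.sum_le_sum fun i _ => by nlinarith [h0 i, hle i]
  rw [← hS]
  obtain ⟨L, hL⟩ : ∃ L, L = (1 - S) / ((d : ℝ) - 1) := ⟨_, rfl⟩
  have hL' : L * ((d : ℝ) - 1) = 1 - S := by
    rw [hL]; exact div_mul_cancel₀ _ (by linarith)
  rw [← hL]
  have key : ∃ i, π0 i < 1 ∧ L * (1 - π0 i) ≤ π0 i - 2 * π0 i ^ 2 + π0 i * S := by
    by_contra hcon
    push Not at hcon
    have hex : ∃ i, π0 i < 1 := by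
      by_contra hh
      push Not at hh
      have : ∑ i : Fin d, (1:ℝ) ≤ ∑ i, π0 i := Finset.sum_le_sum fun i _ => hh i
      simp [h1] at this
      omega
    obtain ⟨k, hk⟩ := hex
    have hlt : ∑ i, (π0 i - 2 * π0 i ^ 2 + π0 i * S) < ∑ i, L * (1 - π0 i) := by
      apply Finset.sum_lt_sum
      · intro i _
        rcases (hle i).lt_or_eq with h | h
        · exact (hcon i h).le
        · rw [h]; linarith
      · exact ⟨k, Finset.mem_univ k, hcon k hk⟩
    rw [← Finset.mul_sum, Finset.sum_add_distrib, Finset.sum_sub_distrib,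
      Finset.sum_sub_distrib, ← Finset.mul_sum, ← Finset.sum_mul, h1, ← hS] at hlt
    simp at hlt
    linarith
  obtain ⟨i, hi, hQ⟩ := key
  have hpos : 0 < 1 - π0 i := by linarith
  obtain ⟨t, ht⟩ : ∃ t : Fin d → ℝ, t = fun j => Real.sqrt (π0 j) := ⟨_, rfl⟩
  have ht2 : ∀ j, t j ^ 2 = π0 j := fun j => by rw [ht]; exact Real.sq_sqrt (h0 j)
  obtain ⟨c, hc⟩ : ∃ c, c = Real.sqrt (1 - π0 i) := ⟨_, rfl⟩
  have hc2 : c ^ 2 = 1 - π0 i := by rw [hc]; exact Real.sq_sqrt hpos.le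
  have hsq : ∀ j, (((if j = i then 1 else 0) - t i * t j) / c) ^ 2
      = ((if j = i then 1 - 2 * π0 i else 0) + π0 i * π0 j) / (1 - π0 i) := by
    intro j
    rw [div_pow, hc2]
    congr 1
    split_ifs with h
    · subst h; rw [← ht2 j]; ring
    · rw [← ht2 j, ← ht2 i]; ring
  refine ⟨fun j => ((if j = i then 1 else 0) - t i * t j) / c, ?_, ?_, ?_⟩
  · simp only [hsq]
    rw [← Finset.sum_div, Finset.sum_add_distrib, ← Finset.mul_sum, h1, div_eq_one_iff_eq hpos.ne']
    simp
    ring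
  · have : ∀ j, ((if j = i then 1 else 0) - t i * t j) / c * Real.sqrt (π0 j)
        = ((if j = i then t i else 0) - t i * π0 j) / c := by
      intro j
      have e : Real.sqrt (π0 j) = t j := by rw [ht]
      rw [e, div_mul_eq_mul_div]
      congr 1
      split_ifs with h
      · subst h; rw [← ht2 j]; ring
      · rw [← ht2 j]; ring
    simp only [this]
    rw [← Finset.sum_div, Finset.sum_sub_distrib, ← Finset.mul_sum, h1]
    simp
  · have : ∀ j, π0 j * ((((if j = i then 1 else 0) - t i * t j) / c) ^ 2)
        = ((if j = i then π0 i * (1 - 2 * π0 i) else 0) + π0 i * π0 j ^ 2) / (1 - π0 i) := by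
      intro j
      rw [hsq, mul_div_assoc']
      congr 1
      split_ifs with h
      · subst h; ring
      · ring
    simp only [this]
    rw [← Finset.sum_div, Finset.sum_add_distrib, ← Finset.mul_sum, ← hS, le_div_iff₀ hpos]
    simp
    linarith
end

section
/- Let π⁰ be a probability vector on [d] with θ⁰_i = √(π⁰_i), let g ∈ ℝ^d be a unit vector with ⟨g, θ⁰⟩ = 0, and let 0 ≤ τ ≤ 1. Define π^(g) ∈ ℝ^d by π^(g)_i = (θ⁰_i + τ·g_i)² / (1 + τ²). Then: (1) ‖θ⁰ + τg‖² = 1 + τ², so π^(g) is a probability vector on [d]; and (2) Σ_{i=1}^d (π^(g)_i − π⁰_i)² ≤ 12τ². -/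
open Finset

/-- For a unit vector g orthogonal to θ⁰ = √π⁰ and 0 ≤ τ ≤ 1, with
π^(g)_i = (θ⁰_i + τg_i)²/(1 + τ²): (1) ‖θ⁰ + τg‖² = 1 + τ², so π^(g) is a probability
vector; and (2) Σ_i (π^(g)_i − π⁰_i)² ≤ 12τ². -/
theorem stmt_11 {d : ℕ} (hd : 1 ≤ d)
    (π0 : Fin d → ℝ) (hπ0 : IsProbVec π0)
    (g : Fin d → ℝ) (hg : ∑ i, g i ^ 2 = 1)
    (horth : ∑ i, g i * Real.sqrt (π0 i) = 0)
    (τ : ℝ) (hτ0 : 0 ≤ τ) (hτ1 : τ ≤ 1) :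
    (∑ i, (Real.sqrt (π0 i) + τ * g i) ^ 2 = 1 + τ ^ 2) ∧
      IsProbVec (fun i => (Real.sqrt (π0 i) + τ * g i) ^ 2 / (1 + τ ^ 2)) ∧
      ∑ i, ((Real.sqrt (π0 i) + τ * g i) ^ 2 / (1 + τ ^ 2) - π0 i) ^ 2 ≤ 12 * τ ^ 2 := by
  obtain ⟨h0, h1⟩ := hπ0
  have hs : ∀ i, Real.sqrt (π0 i) ^ 2 = π0 i := fun i => Real.sq_sqrt (h0 i)
  have hpos : (0 : ℝ) < 1 + τ ^ 2 := by positivity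
  have hA : ∑ i, (Real.sqrt (π0 i) + τ * g i) ^ 2 = 1 + τ ^ 2 := by
    have : ∀ i, (Real.sqrt (π0 i) + τ * g i) ^ 2
        = π0 i + 2 * τ * (g i * Real.sqrt (π0 i)) + τ ^ 2 * g i ^ 2 := by
      intro i
      linear_combination hs i
    simp_rw [this]
    rw [Finset.sum_add_distrib, Finset.sum_add_distrib, ← Finset.mul_sum, ← Finset.mul_sum,
      h1, horth, hg]
    ring
  refine ⟨hA, ⟨fun i => by positivity, ?_⟩, ?_⟩
  · rw [← Finset.sum_div, hA, div_self hpos.ne']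
  · have key : ∀ i, ((Real.sqrt (π0 i) + τ * g i) ^ 2 / (1 + τ ^ 2) - π0 i) ^ 2
        ≤ 2 * τ ^ 2 * (π0 i + g i ^ 2) := by
      intro i
      have hp1 : π0 i ≤ 1 := by
        rw [← h1]
        exact Finset.single_le_sum (fun j _ => h0 j) (Finset.mem_univ i)
      have hg1 : g i ^ 2 ≤ 1 := by
        rw [← hg]
        exact Finset.single_le_sum (f := fun j => g j ^ 2) (fun j _ => sq_nonneg _)
          (Finset.mem_univ i)
      have hp0 := h0 i
      have hi := hs i
      generalize Real.sqrt (π0 i) = t at hi ⊢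
      rw [← hi] at hp1 hp0 ⊢
      generalize g i = y at hg1 ⊢
      have e : (t + τ * y) ^ 2 / (1 + τ ^ 2) - t ^ 2
          = τ * (2 * t * y + τ * (y ^ 2 - t ^ 2)) / (1 + τ ^ 2) := by
        field_simp
        ring
      have c : (2 * t * y + τ * (y ^ 2 - t ^ 2)) ^ 2 ≤ (1 + τ ^ 2) * (t ^ 2 + y ^ 2) ^ 2 := by
        nlinarith [sq_nonneg (τ * (2 * t * y) - (y ^ 2 - t ^ 2))]
      have b : (t ^ 2 + y ^ 2) ^ 2 ≤ 2 * (t ^ 2 + y ^ 2) := by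
        nlinarith [sq_nonneg y]
      rw [e, div_pow, div_le_iff₀ (by positivity), mul_pow]
      have f : (1 + τ ^ 2) * (t ^ 2 + y ^ 2) ^ 2
          ≤ (1 + τ ^ 2) ^ 2 * (2 * (t ^ 2 + y ^ 2)) := by
        apply mul_le_mul _ b (by positivity) (by positivity)
        nlinarith [sq_nonneg τ]
      have := mul_le_mul_of_nonneg_left (c.trans f) (sq_nonneg τ)
      linarith
    refine (Finset.sum_le_sum fun i _ => key i).trans ?_
    rw [← Finset.mul_sum, Finset.sum_add_distrib, h1, hg]
    nlinarith [sq_nonneg τ]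
end

section
/- For every integer l ≥ 0 there exists a constant c_l > 0, depending only on l, such that for every integer n with l < n/2 − 1, every integer d ≥ 1, and every probability vector π on [d], the Good-Turing estimate M̂_l = ((l+1)/(n−l)) · φ_{l+1} satisfies E[(M_l − M̂_l)²] ≤ c_l/n. -/
open Finset

/-- `M_l`: the total π-mass of symbols appearing exactly l times in the sample x. -/
noncomputable def massL {d n : ℕ} (π : Fin d → ℝ) (l : ℕ) (x : Fin n → Fin d) : ℝ :=
  ∑ i, if cnt x i = l then π i else 0

/-- `φ_l`: the number of symbols appearing exactly l times in the sample x. -/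
def phiL {d n : ℕ} (l : ℕ) (x : Fin n → Fin d) : ℕ :=
  (Finset.univ.filter (fun i : Fin d => cnt x i = l)).card


noncomputable def JJ (p q r : ℝ) : ℕ → ℕ → ℕ → ℝ
  | 0, a, b => if a = 0 ∧ b = 0 then 1 else 0
  | (n+1), a, b => p * (match a with | 0 => 0 | a+1 => JJ p q r n a b)
      + q * (match b with | 0 => 0 | b+1 => JJ p q r n a b) + r * JJ p q r n a b

theorem JJ_bd (p q r : ℝ) (hp : 0 ≤ p) (hq : 0 ≤ q) (hr : 0 ≤ r) (h : p + q + r = 1) (n : ℕ) :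
    ∀ a b, 0 ≤ JJ p q r n a b ∧ JJ p q r n a b ≤ 1 := by
  induction n with
  | zero => intro a b; simp only [JJ]; split_ifs <;> norm_num
  | succ n ih =>
    have key : ∀ u v w : ℝ, (0 ≤ u ∧ u ≤ 1) → (0 ≤ v ∧ v ≤ 1) → (0 ≤ w ∧ w ≤ 1) →
        0 ≤ p * u + q * v + r * w ∧ p * u + q * v + r * w ≤ 1 := by
      intro u v w hu hv hw
      refine ⟨by have := hu.1; have := hv.1; have := hw.1; positivity, ?_⟩
      nlinarith [mul_le_mul_of_nonneg_left hu.2 hp, mul_le_mul_of_nonneg_left hv.2 hq,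
        mul_le_mul_of_nonneg_left hw.2 hr]
    intro a b
    cases a <;> cases b <;> simp only [JJ] <;> apply key <;> first | exact ih _ _ | norm_num

theorem JJ_A (p q r : ℝ) (n : ℕ) :
    ∀ a b : ℕ, ((a:ℝ)+1) * JJ p q r (n+1) (a+1) b = ((n:ℝ)+1) * p * JJ p q r n a b := by
  induction n with
  | zero => 
    intro a b
    rcases a with _ | a <;> rcases b with _ | b <;> simp [JJ]
  | succ n ih =>
    intro a b
    have hrec : JJ p q r (n+1+1) (a+1) b = p * JJ p q r (n+1) a b
      + q * (match b with | 0 => 0 | b+1 => JJ p q r (n+1) (a+1) b) + r * JJ p q r (n+1) (a+1) b := by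
      cases b <;> rfl
    rw [hrec]
    clear hrec
    rcases a with _ | a <;> rcases b with _ | b
    · have h2 := ih 0 0
      rw [show JJ p q r (n+1) 0 0 = p * 0 + q * 0 + r * JJ p q r n 0 0 from rfl]
      push_cast at *
      linear_combination r * h2
    · have h1 := ih 0 b
      have h2 := ih 0 (b+1)
      rw [show JJ p q r (n+1) 0 (b+1) = p * 0 + q * JJ p q r n 0 b + r * JJ p q r n 0 (b+1) from rfl]
      push_cast at *
      linear_combination r * h2 + q * h1
    · have h1 := ih a 0
      have h2 := ih (a+1) 0
      have h3 : JJ p q r (n+1) (a+1) 0 = p * JJ p q r n a 0 + q * 0 + r * JJ p q r n (a+1) 0 := rfl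
      push_cast at *
      linear_combination r * h2 + p * h1 - (n+1) * p * h3
    · have h1 := ih a (b+1)
      have h2 := ih (a+1) (b+1)
      have h4 := ih (a+1) b
      have h3 : JJ p q r (n+1) (a+1) (b+1) = p * JJ p q r n a (b+1) + q * JJ p q r n (a+1) b + r * JJ p q r n (a+1) (b+1) := rfl
      push_cast at *
      linear_combination r * h2 + p * h1 + q * h4 - (n+1) * p * h3

theorem JJ_symm (p q r : ℝ) (n : ℕ) : ∀ a b, JJ p q r n a b = JJ q p r n b a := by
  induction n with
  | zero => intro a b; simp [JJ, and_comm]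
  | succ n ih =>
    intro a b
    rcases a with _ | a <;> rcases b with _ | b <;> simp only [JJ] <;> simp only [ih] <;> ring

theorem JJ_B (p q r : ℝ) (n : ℕ) (a b : ℕ) :
    ((b:ℝ)+1) * JJ p q r (n+1) a (b+1) = ((n:ℝ)+1) * q * JJ p q r n a b := by
  rw [JJ_symm, JJ_A, JJ_symm]

theorem JJ_C (p q r : ℝ) (n : ℕ) (a b : ℕ) :
    ((n:ℝ)+1-a-b) * JJ p q r (n+1) a b = ((n:ℝ)+1) * r * JJ p q r n a b := by
  rcases a with _ | a <;> rcases b with _ | b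
  · have h3 : JJ p q r (n+1) 0 0 = p * 0 + q * 0 + r * JJ p q r n 0 0 := rfl
    push_cast
    linear_combination (n+1) * h3
  · have h3 : JJ p q r (n+1) 0 (b+1) = p * 0 + q * JJ p q r n 0 b + r * JJ p q r n 0 (b+1) := rfl
    have h2 := JJ_B p q r n 0 b
    push_cast
    linear_combination (n+1) * h3 - h2
  · have h3 : JJ p q r (n+1) (a+1) 0 = p * JJ p q r n a 0 + q * 0 + r * JJ p q r n (a+1) 0 := rfl
    have h2 := JJ_A p q r n a 0
    push_cast
    linear_combination (n+1) * h3 - h2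
  · have h3 : JJ p q r (n+1) (a+1) (b+1) = p * JJ p q r n a (b+1) + q * JJ p q r n (a+1) b + r * JJ p q r n (a+1) (b+1) := rfl
    have h2 := JJ_A p q r n a (b+1)
    have h4 := JJ_B p q r n (a+1) b
    push_cast
    linear_combination (n+1) * h3 - h2 - h4

def cS {d n : ℕ} (x : Fin n → Fin d) (S : Finset (Fin d)) : ℕ := ∑ k, if x k ∈ S then 1 else 0

theorem cS_single {d n : ℕ} (x : Fin n → Fin d) (i : Fin d) : cS x {i} = cnt x i := by
  simp [cS, cnt]

theorem expect_succ {d n : ℕ} (π : Fin d → ℝ) (f : (Fin (n+1) → Fin d) → ℝ) :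
    expect π f = ∑ y, π y * expect π (fun x : Fin n → Fin d => f (Fin.cons y x)) := by
  unfold _root_.expect
  rw [← (Fin.consEquiv (fun _ : Fin (n+1) => Fin d)).sum_comp, Fintype.sum_prod_type]
  refine Finset.sum_congr rfl fun y _ => ?_
  rw [Finset.mul_sum]
  refine Finset.sum_congr rfl fun x _ => ?_
  simp only [Fin.consEquiv, prodProb, Equiv.coe_fn_mk, Fin.prod_univ_succ, Fin.cons_zero, Fin.cons_succ]
  ring

theorem cS_cons {d n : ℕ} (y : Fin d) (x : Fin n → Fin d) (S : Finset (Fin d)) :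
    cS (Fin.cons y x : Fin (n+1) → Fin d) S = (if y ∈ S then 1 else 0) + cS x S := by
  simp only [cS, Fin.sum_univ_succ, Fin.cons_zero, Fin.cons_succ]

noncomputable def prd (f : ℕ → ℝ) : ℕ → ℝ
  | 0 => 0
  | a+1 => f a

theorem expect_JJ {d : ℕ} (π : Fin d → ℝ) (hπ : ∑ i, π i = 1) (S T : Finset (Fin d))
    (hST : Disjoint S T) (n : ℕ) : ∀ a b,
    expect π (fun x : Fin n → Fin d => if cS x S = a ∧ cS x T = b then 1 else 0)
      = JJ (∑ i ∈ S, π i) (∑ i ∈ T, π i) (1 - ∑ i ∈ S, π i - ∑ i ∈ T, π i) n a b := by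
  induction n with
  | zero => intro a b; simp [_root_.expect, JJ, cS, prodProb, eq_comm]
  | succ n ih =>
    intro a b
    rw [expect_succ]
    have h0 : expect π (fun _ : Fin n → Fin d => 0) = 0 := by simp [_root_.expect]
    set F := JJ (∑ i ∈ S, π i) (∑ i ∈ T, π i) (1 - ∑ i ∈ S, π i - ∑ i ∈ T, π i) with hF
    obtain ⟨G1, hG1⟩ : ∃ G1 : ℝ, G1 = prd (fun a => F n a b) a := ⟨_, rfl⟩
    obtain ⟨G2, hG2⟩ : ∃ G1 : ℝ, G1 = prd (fun b => F n a b) b := ⟨_, rfl⟩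
    have hR : F (n+1) a b = (∑ i ∈ S, π i) * G1 + (∑ i ∈ T, π i) * G2
      + (1 - ∑ i ∈ S, π i - ∑ i ∈ T, π i) * F n a b := by rw [hG1, hG2]; cases a <;> cases b <;> rfl
    have key : ∀ y, π y * expect π (fun x : Fin n → Fin d =>
        if cS (Fin.cons y x : Fin (n+1) → Fin d) S = a ∧
          cS (Fin.cons y x : Fin (n+1) → Fin d) T = b then (1:ℝ) else 0) =
        (if y ∈ S then π y else 0) * G1 + (if y ∈ T then π y else 0) * G2 +
        (π y - (if y ∈ S then π y else 0) - (if y ∈ T then π y else 0)) * F n a b := by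
      intro y
      simp only [cS_cons]
      by_cases hS : y ∈ S
      · have hT : y ∉ T := Finset.disjoint_left.mp hST hS
        simp only [hS, hT, if_true, if_false, zero_add]
        have : expect π (fun x : Fin n → Fin d => if 1 + cS x S = a ∧ cS x T = b then (1:ℝ) else 0) = G1 := by
          rcases a with _ | a
          · simp [hG1, prd, h0]
          · simp only [hG1, prd]; rw [← ih]; simp [add_comm 1]
        rw [this]; ring
      · by_cases hT : y ∈ T
        · simp only [hS, hT, if_true, if_false, zero_add]
          have : expect π (fun x : Fin n → Fin d => if cS x S = a ∧ 1 + cS x T = b then (1:ℝ) else 0) = G2 := by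
            rcases b with _ | b
            · simp [hG2, prd, h0]
            · simp only [hG2, prd]; rw [← ih]; simp [add_comm 1]
          rw [this]; ring
        · simp only [hS, hT, if_false, zero_add, ih]
          ring
    rw [Finset.sum_congr rfl fun y _ => key y, hR]
    simp only [Finset.sum_add_distrib, ← Finset.sum_mul, Finset.sum_sub_distrib, hπ,
      Finset.sum_ite_mem, Finset.univ_inter]

theorem expect_add {d n : ℕ} (π : Fin d → ℝ) (f g : (Fin n → Fin d) → ℝ) :
    expect π (fun x => f x + g x) = expect π f + expect π g := by
  simp [_root_.expect, mul_add, Finset.sum_add_distrib]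

theorem expect_smul {d n : ℕ} (π : Fin d → ℝ) (c : ℝ) (f : (Fin n → Fin d) → ℝ) :
    expect π (fun x => c * f x) = c * expect π f := by
  simp only [_root_.expect, Finset.mul_sum]
  exact Finset.sum_congr rfl fun _ _ => by ring

theorem expect_sum {d n : ℕ} {ι : Type*} (s : Finset ι) (π : Fin d → ℝ) (f : ι → (Fin n → Fin d) → ℝ) :
    expect π (fun x => ∑ i ∈ s, f i x) = ∑ i ∈ s, expect π (f i) := by
  simp only [_root_.expect, Finset.mul_sum]
  exact Finset.sum_comm

theorem sq_aux (p q r ε : ℝ) (h : p + q + r = 1) (h0 : 0 ≤ ε) (h1 : ε ≤ 1) :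
    (r - (1-ε))^2 ≤ 3 * ε^2 * r^2 + 3 * p^2 + 3 * q^2 := by
  have e : r - (1-ε) = ε * r - (1-ε) * (p+q) := by linear_combination (1-ε) * h
  have h1 : (1-ε)^2 ≤ 1 := by nlinarith
  have h2 : (r - (1-ε))^2 ≤ 3 * (ε*r)^2 + 3 * ((1-ε)*p)^2 + 3 * ((1-ε)*q)^2 := by
    rw [e]
    linarith [sq_nonneg (ε*r + (1-ε)*p), sq_nonneg (ε*r + (1-ε)*q), sq_nonneg ((1-ε)*p - (1-ε)*q)]
  have h3 := mul_le_mul_of_nonneg_right h1 (sq_nonneg p)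
  have h4 := mul_le_mul_of_nonneg_right h1 (sq_nonneg q)
  rw [mul_pow, mul_pow, mul_pow] at h2
  linarith

/-- off-diagonal estimate; here `n = m + 2`. -/
theorem offdiag (p q r L N : ℝ) (m l : ℕ) (hp : 0 ≤ p) (hq : 0 ≤ q) (hr : 0 ≤ r) (h : p + q + r = 1)
    (hL : L = l) (hN : N = m + 2) (hm : 2 * l + 1 ≤ m) :
    p * q * JJ p q r (m+2) l l - (L+1)/(N-L) * p * JJ p q r (m+2) l (l+1)
      - (L+1)/(N-L) * q * JJ p q r (m+2) (l+1) l
      + ((L+1)/(N-L))^2 * JJ p q r (m+2) (l+1) (l+1)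
    ≤ p * q * ((12 * L^2 + 6 * (L+1)*(L+2)*(2*L+2)) / N) := by
  have hL0 : 0 ≤ L := by rw [hL]; positivity
  have hmr : 2 * L + 1 ≤ N - 2 := by rw [hL, hN]; have : ((2*l+1 : ℕ):ℝ) ≤ m := by exact_mod_cast hm
                                     push_cast at this; linarith
  have hX0 := (JJ_bd p q r hp hq hr h m l l)
  have b1 := (JJ_bd p q r hp hq hr h (m+2) l l).2
  have b2 := (JJ_bd p q r hp hq hr h (m+2) (l+2) l).2
  have b3 := (JJ_bd p q r hp hq hr h (m+2) l (l+2)).2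
  have e1 := JJ_C p q r (m+1) l l
  have e2 := JJ_C p q r m l l
  have e3 := JJ_A p q r (m+1) l l
  have e4 := JJ_B p q r (m+1) l l
  have e5 := JJ_A p q r (m+1) l (l+1)
  have e6 := JJ_B p q r m l l
  have e7 := JJ_A p q r (m+1) (l+1) l
  have e8 := JJ_A p q r m l l
  have e9 := JJ_B p q r (m+1) l (l+1)
  simp only [show m + 1 + 1 = m + 2 from rfl, show l + 1 + 1 = l + 2 from rfl] at *
  set X := JJ p q r m l l
  set Y := JJ p q r (m+1) l l
  set J0 := JJ p q r (m+2) l l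
  set J1 := JJ p q r (m+2) (l+1) l
  set J2 := JJ p q r (m+2) l (l+1)
  set J3 := JJ p q r (m+2) (l+1) (l+1)
  set J4 := JJ p q r (m+2) (l+2) l
  set J5 := JJ p q r (m+2) l (l+2)
  set K1 := JJ p q r (m+1) l (l+1)
  set K2 := JJ p q r (m+1) (l+1) l
  push_cast at *
  rw [← hL] at e1 e2 e3 e4 e5 e7 e6 e8 e9
  have hmN : (m:ℝ) = N - 2 := by linarith
  rw [hmN] at e1 e2 e3 e4 e5 e6 e7 e8 e9
  clear_value J0 J1 J2 J3 J4 J5 K1 K2 X Y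
  -- set W = N (N-1) X
  obtain ⟨W, hW⟩ : ∃ W, W = N * (N-1) * X := ⟨_, rfl⟩
  have hW0 : 0 ≤ W := by rw [hW]; exact mul_nonneg (mul_nonneg (by linarith) (by linarith)) hX0.1
  obtain ⟨s, hs⟩ : ∃ s, s = N - 2 * L - 1 := ⟨_, rfl⟩
  have hs2 : 2 ≤ s := by linarith
  have sp : 0 < s := by linarith
  have sp1 : 0 < s + 1 := by linarith
  have hNL : 0 < N - L := by linarith
  have hNp : 0 < N := by linarith
  have g0 : s * (s+1) * J0 = W * r^2 := by
    rw [hs, hW]; linear_combination (N - 2*L - 1) * e1 + N * r * e2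
  have g1 : s * ((L+1) * J1) = W * p * r := by
    rw [hs, hW]; linear_combination (N - 2*L - 1) * e3 + N * p * e2
  have g2 : s * ((L+1) * J2) = W * q * r := by
    rw [hs, hW]; linear_combination (N - 2*L - 1) * e4 + N * q * e2
  have g3 : (L+1)^2 * J3 = W * p * q := by
    rw [hW]; linear_combination (L+1) * e5 + N * p * e6
  have g4 : (L+1)*(L+2) * J4 = W * p^2 := by
    rw [hW]; linear_combination (L+1) * e7 + N * p * e8
  have g5 : (L+1)*(L+2) * J5 = W * q^2 := by
    rw [hW]; linear_combination (L+1) * e9 + N * q * e6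
  have i0 : J0 = W * r^2 / (s * (s+1)) := by field_simp; linarith
  have i1 : (L+1) * J1 = W * p * r / s := by field_simp; linarith
  have i2 : (L+1) * J2 = W * q * r / s := by field_simp; linarith
  have c0 : W * r^2 ≤ s * (s+1) := by rw [← g0]; exact mul_le_of_le_one_right (by positivity) b1
  have c4 : W * p^2 ≤ (L+1)*(L+2) := by rw [← g4]; exact mul_le_of_le_one_right (by positivity) b2
  have c5 : W * q^2 ≤ (L+1)*(L+2) := by rw [← g5]; exact mul_le_of_le_one_right (by positivity) b3
  obtain ⟨ε, hε⟩ : ∃ ε, ε = L / (N-L) := ⟨_, rfl⟩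
  have hε0 : 0 ≤ ε := by rw [hε]; positivity
  have hε1 : ε ≤ 1 := by rw [hε, div_le_one hNL]; linarith
  have hεN : ε ≤ 2 * L / N := by
    rw [hε, div_le_div_iff₀ hNL hNp]
    have := mul_nonneg hL0 (by linarith : (0:ℝ) ≤ N - 2 * L)
    linarith
  have hεs : 1 - ε = (s+1) / (N-L) := by rw [hε, hs]; field_simp; ring
  have eq : p * q * J0 - (L+1)/(N-L) * p * J2 - (L+1)/(N-L) * q * J1 + ((L+1)/(N-L))^2 * J3
      = p * q * (W * ((r - (1-ε))^2 - (s+1)/(N-L)^2) / (s*(s+1))) := by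
    have : p * q * J0 - (L+1)/(N-L) * p * J2 - (L+1)/(N-L) * q * J1 + ((L+1)/(N-L))^2 * J3
      = p * q * J0 - p * ((L+1) * J2) / (N-L) - q * ((L+1) * J1) / (N-L)
        + ((L+1)^2 * J3) / (N-L)^2 := by field_simp
    rw [this, i0, i1, i2, g3, hεs]
    field_simp
    ring
  rw [eq]
  apply mul_le_mul_of_nonneg_left _ (mul_nonneg hp hq)
  have sq := sq_aux p q r ε h hε0 hε1
  have st : W * ((r - (1-ε))^2 - (s+1)/(N-L)^2) ≤ 3 * ε^2 * (s*(s+1)) + 6 * ((L+1)*(L+2)) := by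
    have : 0 ≤ (s+1)/(N-L)^2 := by positivity
    calc W * ((r - (1-ε))^2 - (s+1)/(N-L)^2) ≤ W * (3 * ε^2 * r^2 + 3 * p^2 + 3 * q^2) :=
          mul_le_mul_of_nonneg_left (by linarith) hW0
      _ = 3 * ε^2 * (W * r^2) + 3 * (W * p^2) + 3 * (W * q^2) := by ring
      _ ≤ _ := by
        have := mul_le_mul_of_nonneg_left c0 (sq_nonneg ε)
        linarith
  have hN1 : 1 ≤ N := by linarith
  have f1 : ε^2 ≤ 4 * L^2 / N := by
    calc ε^2 ≤ (2*L/N)^2 := by gcongr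
      _ = 4 * L^2 / N / N := by field_simp; ring
      _ ≤ _ := div_le_self (by positivity) hN1
  have f2 : 1 / (s * (s+1)) ≤ (2*L+2) / N := by
    rw [div_le_div_iff₀ (by positivity) hNp]
    have : N = s + 2 * L + 1 := by linarith
    rw [this]
    have hss : 0 ≤ s * (s - 2) := mul_nonneg sp.le (by linarith)
    have := mul_nonneg hL0 (by linarith : (0:ℝ) ≤ s*(s+1) - 1)
    linarith
  calc W * ((r - (1-ε))^2 - (s+1)/(N-L)^2) / (s*(s+1))
      ≤ (3 * ε^2 * (s*(s+1)) + 6 * ((L+1)*(L+2))) / (s*(s+1)) := by gcongr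
    _ = 3 * ε^2 + 6 * ((L+1)*(L+2)) * (1 / (s*(s+1))) := by field_simp
    _ ≤ 3 * (4 * L^2 / N) + 6 * ((L+1)*(L+2)) * ((2*L+2) / N) := by gcongr
    _ = _ := by ring

theorem diag (p r L N : ℝ) (m l : ℕ) (hp : 0 ≤ p) (hr : 0 ≤ r) (h : p + r = 1)
    (hL : L = l) (hN : N = m + 1) (hm : 2 * L ≤ N) :
    p^2 * JJ p 0 r (m+1) l 0 + ((L+1)/(N-L))^2 * JJ p 0 r (m+1) (l+1) 0
    ≤ p * (5 * (L+1) / N) := by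
  have hL0 : 0 ≤ L := by rw [hL]; positivity
  have hNp : 0 < N := by rw [hN]; positivity
  have e1 := JJ_A p 0 r (m+1) l 0
  have e2 := JJ_A p 0 r m l 0
  have b1 := (JJ_bd p 0 r hp le_rfl hr (by linarith) (m+2) (l+1) 0).2
  have b2 := (JJ_bd p 0 r hp le_rfl hr (by linarith) m l 0).2
  simp only [show m + 1 + 1 = m + 2 from rfl] at *
  push_cast at *
  rw [← hL] at e1 e2
  rw [← hN] at e1 e2
  set J1 := JJ p 0 r (m+1) l 0
  set J2 := JJ p 0 r (m+1) (l+1) 0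
  have h1 : p * J1 ≤ (L+1)/N := by
    rw [le_div_iff₀ hNp]
    have : (L+1) * JJ p 0 r (m+2) (l+1) 0 ≤ L+1 := mul_le_of_le_one_right (by positivity) b1
    have := mul_nonneg hp (JJ_bd p 0 r hp le_rfl hr (by linarith) (m+1) l 0).1
    nlinarith
  have h2 : (L+1) * J2 ≤ N * p := by
    rw [e2]; exact mul_le_of_le_one_right (by positivity) b2
  have hNL : N/2 ≤ N - L := by linarith
  have h3 : ((L+1)/(N-L))^2 * J2 ≤ p * (4 * (L+1)/N) := by
    calc ((L+1)/(N-L))^2 * J2 = (L+1) * ((L+1)*J2) / (N-L)^2 := by rw [div_pow]; ring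
      _ ≤ (L+1) * (N * p) / (N/2)^2 := by gcongr
      _ = _ := by field_simp; ring
  calc _ ≤ p * ((L+1)/N) + p * (4 * (L+1)/N) := by
        have := mul_le_mul_of_nonneg_left h1 hp
        nlinarith
    _ = _ := by ring

/-- For every l ≥ 0 there is a constant c_l > 0 such that for all n with
l < n/2 − 1, all d and all probability vectors π, the Good-Turing estimate
M̂_l = ((l+1)/(n−l))·φ_{l+1} satisfies E[(M_l − M̂_l)²] ≤ c_l/n. -/
theorem stmt_15 (l : ℕ) :
    ∃ c : ℝ, 0 < c ∧
      ∀ (n d : ℕ) (π : Fin d → ℝ), IsProbVec π → (l : ℝ) < (n : ℝ) / 2 - 1 →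
        expect π (fun x : Fin n → Fin d =>
            (massL π l x - ((l : ℝ) + 1) / ((n : ℝ) - l) * phiL (l + 1) x) ^ 2) ≤
          c / n := by
  refine ⟨5 * ((l:ℝ)+1) + (12 * (l:ℝ)^2 + 6 * ((l:ℝ)+1)*((l:ℝ)+2)*(2*(l:ℝ)+2)), by positivity, ?_⟩
  intro n d π hπ hn
  have hln : 2 * l + 2 < n := by
    have : ((2 * l + 2 : ℕ) : ℝ) < n := by push_cast; linarith
    exact_mod_cast this
  obtain ⟨m, rfl⟩ : ∃ m, n = m + 2 := ⟨n - 2, by omega⟩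
  obtain ⟨hpos, hsum⟩ := hπ
  obtain ⟨α, hα⟩ : ∃ α : ℝ, α = ((l : ℝ) + 1) / (((m+2:ℕ) : ℝ) - l) := ⟨_, rfl⟩
  rw [← hα]
  set A : ℝ := 5 * ((l:ℝ)+1) / ((m+2:ℕ):ℝ) with hA
  set B : ℝ := (12 * (l:ℝ)^2 + 6 * ((l:ℝ)+1)*((l:ℝ)+2)*(2*(l:ℝ)+2)) / ((m+2:ℕ):ℝ) with hB
  have hB0 : 0 ≤ B := by positivity
  let D : Fin d → (Fin (m+2) → Fin d) → ℝ := fun i x =>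
    π i * (if cnt x i = l then 1 else 0) - α * (if cnt x i = l+1 then 1 else 0)
  have hD : ∀ x : Fin (m+2) → Fin d, massL π l x - α * phiL (l+1) x = ∑ i, D i x := by
    intro x
    simp only [D, massL, phiL, Finset.sum_sub_distrib, ← Finset.mul_sum]
    simp
  have hexp : expect π (fun x : Fin (m+2) → Fin d => (massL π l x - α * phiL (l+1) x)^2)
      = ∑ i, ∑ j, expect π (fun x => D i x * D j x) := by
    simp only [hD, sq, Finset.sum_mul_sum, expect_sum]
  rw [hexp]
  have hsub : ∀ S : Finset (Fin d), ∑ i ∈ S, π i ≤ 1 := fun S => by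
    rw [← hsum]; exact Finset.sum_le_univ_sum_of_nonneg hpos
  have hdiag : ∀ i, expect π (fun x => D i x * D i x) ≤ π i * A := by
    intro i
    have J := expect_JJ π hsum {i} ∅ (by simp) (m+2)
    simp only [cS_single, Finset.sum_singleton, Finset.sum_empty, sub_zero] at J
    have c0 : ∀ x : Fin (m+2) → Fin d, cS x ∅ = 0 := fun x => by simp [cS]
    have hx : (fun x => D i x * D i x) = fun x : Fin (m+2) → Fin d =>
        (π i)^2 * (if cnt x i = l ∧ cS x ∅ = 0 then 1 else 0) +
          α^2 * (if cnt x i = l+1 ∧ cS x ∅ = 0 then 1 else 0) := by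
      funext x
      simp only [D, c0, and_true]
      by_cases h1 : cnt x i = l
      · simp [h1]; ring
      · by_cases h2 : cnt x i = l + 1
        · simp [h2]; ring
        · simp [h1, h2]
    rw [hx, expect_add, expect_smul, expect_smul, J, J, hα, hA]
    have := hsub {i}
    simp only [Finset.sum_singleton] at this
    exact diag (π i) (1 - π i) l _ (m+1) l (hpos i) (by linarith) (by ring) rfl (by push_cast; ring)
      (by linarith)
  have hoff : ∀ i j, i ≠ j → expect π (fun x => D i x * D j x) ≤ π i * π j * B := by
    intro i j hij
    have J := expect_JJ π hsum {i} {j} (by simpa using hij) (m+2)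
    simp only [cS_single, Finset.sum_singleton] at J
    have hx : (fun x => D i x * D j x) = fun x : Fin (m+2) → Fin d =>
        (π i * π j) * (if cnt x i = l ∧ cnt x j = l then 1 else 0) +
        ((-(α * π i)) * (if cnt x i = l ∧ cnt x j = l+1 then 1 else 0) +
        ((-(α * π j)) * (if cnt x i = l+1 ∧ cnt x j = l then 1 else 0) +
          α^2 * (if cnt x i = l+1 ∧ cnt x j = l+1 then 1 else 0))) := by
      funext x
      have ite_mul' : ∀ (P Q : Prop) [Decidable P] [Decidable Q],
        (if P ∧ Q then (1:ℝ) else 0) = (if P then 1 else 0) * (if Q then 1 else 0) := by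
        intro P Q _ _; by_cases P <;> by_cases Q <;> simp [*]
      simp only [D, ite_mul']
      ring
    rw [hx, expect_add, expect_add, expect_add, expect_smul, expect_smul, expect_smul,
      expect_smul, J, J, J, J, hB]
    have := hsub {i, j}
    rw [Finset.sum_pair hij] at this
    have key := offdiag (π i) (π j) (1 - π i - π j) l ((m+2:ℕ):ℝ) m l (hpos i) (hpos j) (by linarith)
      (by ring) rfl (by push_cast; ring) (by omega)
    rw [← hα] at key
    linarith
  have hall : ∀ i j, expect π (fun x => D i x * D j x) ≤
      (if i = j then π i * A else 0) + π i * π j * B := by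
    intro i j
    by_cases h : i = j
    · subst h
      have := mul_nonneg (mul_nonneg (hpos i) (hpos i)) hB0
      have := hdiag i
      simp only [if_true]; linarith
    · simpa [h] using hoff i j h
  calc _ ≤ ∑ i, ∑ j, ((if i = j then π i * A else 0) + π i * π j * B) :=
        Finset.sum_le_sum fun i _ => Finset.sum_le_sum fun j _ => hall i j
    _ = A + B := by
        simp only [Finset.sum_add_distrib, Finset.sum_ite_eq, Finset.mem_univ, if_true,
          ← Finset.sum_mul, ← Finset.mul_sum, hsum, mul_one, one_mul]
    _ = _ := by rw [hA, hB]; ring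
end
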